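/- arXiv:2507.22162 — 2 statements merged into one kernel-verified Lean document; each statement's English description precedes it below -/
import Mathlib

section
/- Let L be a Lelek fan with top v. Then for each leg A of L there is a Cantor fan C_A ⊆ L such that distinct legs A₁ ≠ A₂ give C_{A₁} ∩ C_{A₂} = {v}, and the union of all C_A over legs A equals L. In other words, L is a union of Cantor fans meeting pairwise only at the top. -/
open Set Topology Filter

section Defs
variable {X : Type*} [TopologicalSpace X]

def IsSubcontinuum (A : Set X) : Prop := IsCompact A ∧ IsConnected A

def IsArc (A : Set X) : Prop := Nonempty (A ≃ₜ (Set.Icc (0:ℝ) 1))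

def IsEndpointOfArc (A : Set X) (x : X) : Prop :=
  ∃ φ : (Set.Icc (0:ℝ) 1) ≃ₜ A, ((φ ⟨0, by norm_num⟩ : A) : X) = x

def IsArcFromTo (A : Set X) (x y : X) : Prop :=
  (x = y ∧ A = {x}) ∨ (x ≠ y ∧ IsArc A ∧ IsEndpointOfArc A x ∧ IsEndpointOfArc A y)

def IsArcwiseConnected (K : Set X) : Prop :=
  ∀ x ∈ K, ∀ y ∈ K, x ≠ y →
    ∃ A, A ⊆ K ∧ IsArc A ∧ IsEndpointOfArc A x ∧ IsEndpointOfArc A y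

def IsUnicoherent (K : Set X) : Prop :=
  ∀ A B : Set X, IsSubcontinuum A → IsSubcontinuum B → A ∪ B = K → IsConnected (A ∩ B)

def IsDendroid (K : Set X) : Prop :=
  IsSubcontinuum K ∧ IsArcwiseConnected K ∧
    ∀ A, A ⊆ K → IsSubcontinuum A → IsUnicoherent A

def triodModel : Set (ℝ × ℝ) := (Set.Icc (-1) 1 ×ˢ ({0} : Set ℝ)) ∪ (({0} : Set ℝ) ×ˢ Set.Icc 0 1)

lemma triod_top_mem : ((0, 0) : ℝ × ℝ) ∈ triodModel := by
  left; exact ⟨by norm_num, rfl⟩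

def IsSimpleTriodWithTop (T : Set X) (x : X) : Prop :=
  ∃ φ : triodModel ≃ₜ T, ((φ ⟨(0, 0), triod_top_mem⟩ : T) : X) = x

def IsRamificationPoint (K : Set X) (x : X) : Prop :=
  x ∈ K ∧ ∃ T, T ⊆ K ∧ IsSimpleTriodWithTop T x

def IsEndpoint (K : Set X) (x : X) : Prop :=
  x ∈ K ∧ ∀ A, A ⊆ K → IsArc A → x ∈ A → IsEndpointOfArc A x

def IsFan (K : Set X) : Prop :=
  IsDendroid K ∧ ∀ x y, IsRamificationPoint K x → IsRamificationPoint K y → x = y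

def IsFanWithTop (K : Set X) (v : X) : Prop := IsFan K ∧ IsRamificationPoint K v

def Legs (K : Set X) (v : X) : Set (Set X) :=
  {A | ∃ e, IsEndpoint K e ∧ A ⊆ K ∧ IsArcFromTo A v e}

def IsRetractOf (B A : Set X) : Prop :=
  ∃ r : X → X, ContinuousOn r A ∧ Set.MapsTo r A B ∧ Set.EqOn r id B

end Defs

section MetricDefs
variable {X : Type*} [MetricSpace X]

def IsSmoothFan (K : Set X) (v : X) : Prop :=
  IsFanWithTop K v ∧
  ∀ x ∈ K, ∀ xs : ℕ → X, (∀ n, xs n ∈ K) → Tendsto xs atTop (nhds x) →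
    ∀ A : Set X, A ⊆ K → IsArcFromTo A v x →
    ∀ As : ℕ → Set X, (∀ n, As n ⊆ K ∧ IsArcFromTo (As n) v (xs n)) →
      Tendsto (fun n => Metric.hausdorffDist (As n) A) atTop (nhds 0)

def IsLelekFan (K : Set X) (v : X) : Prop :=
  IsSmoothFan K v ∧ K ⊆ closure {x | IsEndpoint K x}

def IsWedge (L : Set X) (v : X) (W : Set X) : Prop :=
  W ⊆ L ∧ IsSubcontinuum W ∧ IsLelekFan W v ∧ IsLelekFan ((L \ W) ∪ {v}) v

end MetricDefs

def coneSetoid (Z : Type*) : Setoid (Z × Set.Icc (0:ℝ) 1) where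
  r a b := a = b ∨ ((a.2 : ℝ) = 0 ∧ (b.2 : ℝ) = 0)
  iseqv := by
    refine ⟨fun a => Or.inl rfl, ?_, ?_⟩
    · rintro a b (rfl | h)
      · exact Or.inl rfl
      · exact Or.inr ⟨h.2, h.1⟩
    · rintro a b c (rfl | h) (rfl | h')
      · exact Or.inl rfl
      · exact Or.inr h'
      · exact Or.inr h
      · exact Or.inr ⟨h.1, h'.2⟩

abbrev CantorFanSpace : Type := Quotient (coneSetoid (ℕ → Bool))

def IsCantorFan {X : Type*} [TopologicalSpace X] (K : Set X) (v : X) : Prop :=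
  IsFanWithTop K v ∧ Nonempty (K ≃ₜ CantorFanSpace)

def IsConfluent {X Y : Type*} [TopologicalSpace X] [TopologicalSpace Y] (f : X → Y) : Prop :=
  ∀ Q : Set Y, Q ⊆ Set.range f → IsCompact Q → IsConnected Q →
    ∀ x ∈ f ⁻¹' Q, f '' connectedComponentIn (f ⁻¹' Q) x = Q

section Arcs
variable {X : Type*} [TopologicalSpace X]

lemma homeo_Icc_zero (h : Icc (0:ℝ) 1 ≃ₜ Icc (0:ℝ) 1) : h 0 = 0 ∨ h 0 = 1 := by
  rcases h.continuous.strictMono_of_inj_boundedOrder' h.injective with hm | hm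
  · left
    obtain ⟨t, ht⟩ := h.surjective 0
    exact le_antisymm ((hm.monotone (unitInterval.nonneg' (t := t))).trans_eq ht)
      unitInterval.nonneg'
  · right
    obtain ⟨t, ht⟩ := h.surjective 1
    exact le_antisymm unitInterval.le_one'
      (ht.symm.trans_le (hm.antitone (unitInterval.nonneg' (t := t))))

lemma isClosedEmbedding_restrict [T2Space X] {γ : ℝ → X} {a b : ℝ}
    (hc : ContinuousOn γ (Icc a b)) (hi : InjOn γ (Icc a b)) :
    IsClosedEmbedding ((Icc a b).domRestrict γ) :=
  (continuousOn_iff_continuous_domRestrict.1 hc).isClosedEmbedding (injOn_iff_injective.1 hi)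

lemma exists_homeo_image [T2Space X] {γ : ℝ → X} {a b : ℝ} (hab : a < b)
    (hc : ContinuousOn γ (Icc a b)) (hi : InjOn γ (Icc a b)) :
    ∃ φ : Icc (0:ℝ) 1 ≃ₜ (γ '' Icc a b : Set X),
      ((φ 0 : γ '' Icc a b) : X) = γ a ∧ ((φ 1 : γ '' Icc a b) : X) = γ b := by
  let e := (isClosedEmbedding_restrict hc hi).isEmbedding.toHomeomorph
  have hr : range ((Icc a b).domRestrict γ) = γ '' Icc a b := range_domRestrict _ _
  refine ⟨((iccHomeoI a b hab).symm.trans e).trans (Homeomorph.setCongr hr), ?_, ?_⟩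
  · change γ ((iccHomeoI a b hab).symm 0 : Icc a b) = γ a
    simp
  · change γ ((iccHomeoI a b hab).symm 1 : Icc a b) = γ b
    simp

lemma isArcFromTo_image [T2Space X] {γ : ℝ → X} {a b : ℝ} (hab : a < b)
    (hc : ContinuousOn γ (Icc a b)) (hi : InjOn γ (Icc a b)) :
    IsArcFromTo (γ '' Icc a b) (γ a) (γ b) := by
  obtain ⟨φ, h0, h1⟩ := exists_homeo_image hab hc hi
  refine Or.inr ⟨fun h => hab.ne (hi (left_mem_Icc.2 hab.le) (right_mem_Icc.2 hab.le) h),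
    ⟨φ.symm⟩, ⟨φ, h0⟩, ⟨unitInterval.symmHomeomorph.trans φ, ?_⟩⟩
  rw [← h1]
  change ((φ (unitInterval.symm 0) : γ '' Icc a b) : X) = _
  rw [unitInterval.symm_zero]

lemma IsEndpointOfArc.eq_or_eq [T2Space X] {γ : ℝ → X} {a b : ℝ} (hab : a < b)
    (hc : ContinuousOn γ (Icc a b)) (hi : InjOn γ (Icc a b)) {p : X}
    (hp : IsEndpointOfArc (γ '' Icc a b) p) : p = γ a ∨ p = γ b := by
  obtain ⟨φ, h0, h1⟩ := exists_homeo_image hab hc hi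
  obtain ⟨ψ, hψ⟩ := hp
  change ((ψ 0 : γ '' Icc a b) : X) = p at hψ
  rcases homeo_Icc_zero (ψ.trans φ.symm) with h | h <;>
    rw [Homeomorph.trans_apply, Homeomorph.symm_apply_eq] at h
  · left; rw [← hψ, h, h0]
  · right; rw [← hψ, h, h1]

lemma IsArcFromTo.exists_param {A : Set X} {x y : X} (h : IsArcFromTo A x y) (hxy : x ≠ y) :
    ∃ γ : ℝ → X, Continuous γ ∧ InjOn γ (Icc 0 1) ∧ γ '' Icc 0 1 = A ∧ γ 0 = x ∧ γ 1 = y := by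
  rcases h with h | ⟨-, -, ⟨φ, hφ⟩, ⟨ψ, hψ⟩⟩
  · exact absurd h.1 hxy
  change ((φ 0 : A) : X) = x at hφ
  change ((ψ 0 : A) : X) = y at hψ
  have h1 : ((φ 1 : A) : X) = y := by
    rcases homeo_Icc_zero (ψ.trans φ.symm) with h | h <;>
      rw [Homeomorph.trans_apply, Homeomorph.symm_apply_eq] at h
    · exact absurd (by rw [← hφ, ← hψ, h]) hxy
    · rw [← h, hψ]
  have key : ∀ t (ht : t ∈ Icc (0:ℝ) 1),
      IccExtend zero_le_one (fun t => ((φ t : A) : X)) t = φ ⟨t, ht⟩ :=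
    fun t ht => IccExtend_of_mem zero_le_one _ ht
  refine ⟨IccExtend zero_le_one (fun t => ((φ t : A) : X)), ?_, ?_, ?_, ?_, ?_⟩
  · exact (continuous_subtype_val.comp φ.continuous).Icc_extend'
  · intro s hs t ht hst
    rw [key s hs, key t ht] at hst
    exact congrArg Subtype.val (φ.injective (Subtype.ext hst))
  · ext z
    constructor
    · rintro ⟨t, ht, rfl⟩
      rw [key t ht]; exact (φ _).2
    · intro hz
      obtain ⟨t, ht⟩ := φ.surjective ⟨z, hz⟩
      exact ⟨t, t.2, by rw [key t t.2]; exact congrArg Subtype.val ht⟩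
  · rw [key 0 ⟨le_rfl, zero_le_one⟩, ← hφ]; rfl
  · rw [key 1 ⟨zero_le_one, le_rfl⟩, ← h1]; rfl

lemma IsArc.exists_param {A : Set X} (h : IsArc A) :
    ∃ γ : ℝ → X, Continuous γ ∧ InjOn γ (Icc 0 1) ∧ γ '' Icc 0 1 = A := by
  obtain ⟨φ⟩ := h
  have hne : ((φ.symm 0 : A) : X) ≠ φ.symm 1 := fun h =>
    zero_ne_one (φ.symm.injective (Subtype.ext h))
  obtain ⟨γ, h1, h2, h3, -⟩ := IsArcFromTo.exists_param (A := A)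
    (Or.inr ⟨hne, ⟨φ⟩, ⟨φ.symm, rfl⟩, ⟨unitInterval.symmHomeomorph.trans φ.symm, by
      change ((φ.symm (unitInterval.symm 0) : A) : X) = _
      rw [unitInterval.symm_zero]⟩⟩) hne
  exact ⟨γ, h1, h2, h3⟩

/-- A connected subset of a parametrized arc contains every point between two of its points. -/
lemma IsPreconnected.mem_of_param [T2Space X] {γ : ℝ → X} {a b : ℝ}
    (hc : ContinuousOn γ (Icc a b)) (hi : InjOn γ (Icc a b)) {S : Set X} (hS : IsPreconnected S)
    (hSA : S ⊆ γ '' Icc a b) {s t u : ℝ} (hs : s ∈ Icc a b) (ht : t ∈ Icc a b)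
    (hγs : γ s ∈ S) (hγt : γ t ∈ S) (hu : u ∈ Icc s t) : γ u ∈ S := by
  have he := isClosedEmbedding_restrict hc hi
  have : IsPreconnected ((Icc a b).domRestrict γ ⁻¹' S) := by
    rw [← he.isEmbedding.isPreconnected_image, image_preimage_eq_inter_range, range_domRestrict,
      inter_eq_left.2 hSA]
    exact hS
  exact this.ordConnected.out (x := ⟨s, hs⟩) (y := ⟨t, ht⟩) hγs hγt
    (show (⟨u, hs.1.trans hu.1, hu.2.trans ht.2⟩ : Icc a b) ∈ _ from ⟨hu.1, hu.2⟩)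

lemma isSubcontinuum_image {γ : ℝ → X} {a b : ℝ} (hab : a ≤ b)
    (hc : ContinuousOn γ (Icc a b)) : IsSubcontinuum (γ '' Icc a b) :=
  ⟨isCompact_Icc.image_of_continuousOn hc, (isConnected_Icc hab).image _ hc⟩

lemma IsArcFromTo.isSubcontinuum {A : Set X} {x y : X} (h : IsArcFromTo A x y) :
    IsSubcontinuum A := by
  by_cases hxy : x = y
  · rcases h with h | h
    · rw [h.2]; exact ⟨isCompact_singleton, isConnected_singleton⟩
    · exact absurd hxy h.1
  · obtain ⟨γ, hc, -, rfl, -⟩ := h.exists_param hxy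
    exact isSubcontinuum_image zero_le_one hc.continuousOn

lemma IsArcFromTo.left_mem {A : Set X} {x y : X} (h : IsArcFromTo A x y) : x ∈ A := by
  rcases h with h | ⟨-, -, ⟨φ, hφ⟩, -⟩
  · rw [h.2]; rfl
  · rw [← hφ]; exact (φ _).2

lemma IsArcFromTo.right_mem {A : Set X} {x y : X} (h : IsArcFromTo A x y) : y ∈ A := by
  rcases h with h | ⟨-, -, -, ⟨φ, hφ⟩⟩
  · rw [h.2]; exact h.1.symm
  · rw [← hφ]; exact (φ _).2

/-- The union of two arcs meeting exactly in a common end is an arc. -/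
lemma exists_arc_concat [T2Space X] {γ δ : ℝ → X} {a b c d : ℝ} (hab : a < b) (hcd : c < d)
    (hγ : Continuous γ) (hδ : Continuous δ) (hγi : InjOn γ (Icc a b)) (hδi : InjOn δ (Icc c d))
    (heq : γ b = δ c) (hmeet : ∀ s ∈ Icc a b, ∀ t ∈ Icc c d, γ s = δ t → s = b) :
    IsArcFromTo (γ '' Icc a b ∪ δ '' Icc c d) (γ a) (δ d) := by
  set η : ℝ → X := fun t => if t ≤ b then γ t else δ (t - b + c) with hη
  have hηc : Continuous η := by
    refine Continuous.if_le hγ (by fun_prop) continuous_id continuous_const ?_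
    rintro x rfl
    simpa using heq
  have h1 : ∀ t ≤ b, η t = γ t := fun t ht => if_pos ht
  have h2 : ∀ t, b ≤ t → η t = δ (t - b + c) := fun t ht => by
    rcases ht.eq_or_lt with rfl | ht
    · rw [h1 _ le_rfl, heq]; simp
    · exact if_neg (not_le.2 ht)
  have hηi : InjOn η (Icc a (b + (d - c))) := by
    intro s hs t ht hst
    rcases le_total s b with hsb | hsb <;> rcases le_total t b with htb | htb
    · rw [h1 s hsb, h1 t htb] at hst
      exact hγi ⟨hs.1, hsb⟩ ⟨ht.1, htb⟩ hst
    · rw [h1 s hsb, h2 t htb] at hst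
      have := hmeet s ⟨hs.1, hsb⟩ (t - b + c) ⟨by linarith, by linarith [ht.2]⟩ hst
      subst this
      rw [heq] at hst
      have := hδi ⟨le_rfl, hcd.le⟩ ⟨by linarith, by linarith [ht.2]⟩ hst
      linarith
    · rw [h2 s hsb, h1 t htb] at hst
      have := hmeet t ⟨ht.1, htb⟩ (s - b + c) ⟨by linarith, by linarith [hs.2]⟩ hst.symm
      subst this
      rw [heq] at hst
      have := hδi ⟨by linarith, by linarith [hs.2]⟩ ⟨le_rfl, hcd.le⟩ hst
      linarith
    · rw [h2 s hsb, h2 t htb] at hst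
      have := hδi ⟨by linarith, by linarith [hs.2]⟩ ⟨by linarith, by linarith [ht.2]⟩ hst
      linarith
  have himg : η '' Icc a (b + (d - c)) = γ '' Icc a b ∪ δ '' Icc c d := by
    ext z
    constructor
    · rintro ⟨t, ht, rfl⟩
      rcases le_total t b with htb | htb
      · exact Or.inl ⟨t, ⟨ht.1, htb⟩, (h1 t htb).symm⟩
      · exact Or.inr ⟨t - b + c, ⟨by linarith, by linarith [ht.2]⟩, (h2 t htb).symm⟩
    · rintro (⟨t, ht, rfl⟩ | ⟨t, ht, rfl⟩)
      · exact ⟨t, ⟨ht.1, by linarith [ht.2]⟩, h1 t ht.2⟩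
      · refine ⟨t + b - c, ⟨by linarith [ht.1], by linarith [ht.2]⟩, ?_⟩
        rw [h2 _ (by linarith [ht.1])]; congr 1; ring
  have := isArcFromTo_image (by linarith) hηc.continuousOn hηi
  rwa [himg, h1 a hab.le, h2 _ (by linarith), show b + (d - c) - b + c = d by ring] at this

/-- Three arcs issuing from a point and otherwise disjoint form a simple triod. -/
lemma exists_triod [T2Space X] {γ : Fin 3 → ℝ → X} {z : X} (hc : ∀ i, Continuous (γ i))
    (hi : ∀ i, InjOn (γ i) (Icc 0 1)) (h0 : ∀ i, γ i 0 = z)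
    (hd : ∀ i j, i ≠ j → ∀ s ∈ Icc (0:ℝ) 1, ∀ t ∈ Icc (0:ℝ) 1, γ i s = γ j t → s = 0) :
    ∃ T, T ⊆ (⋃ i, γ i '' Icc 0 1) ∧ IsSimpleTriodWithTop T z := by
  set f : triodModel → X := fun p =>
    if |(p : ℝ × ℝ).1| ≤ (p : ℝ × ℝ).2 then γ 2 (p : ℝ × ℝ).2 else
      if 0 ≤ (p : ℝ × ℝ).1 then γ 0 (p : ℝ × ℝ).1 else γ 1 (-(p : ℝ × ℝ).1) with hf
  have hfc : Continuous f := by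
    have hc0 := hc 0
    have hc1 := hc 1
    have hc2 := hc 2
    refine Continuous.if_le (by fun_prop) ?_ (by fun_prop) (by fun_prop) ?_
    · refine Continuous.if_le (by fun_prop) (by fun_prop) (by fun_prop) (by fun_prop) ?_
      intro p hp
      rw [← hp]; simp [h0]
    · rintro ⟨⟨x, y⟩, hp⟩ h
      simp only at h ⊢
      rcases hp with ⟨-, hy⟩ | ⟨hx, -⟩
      · simp only [mem_singleton_iff] at hy
        subst hy
        rw [abs_eq_zero.1 h]; simp [h0]
      · simp only [mem_singleton_iff] at hx
        subst hx
        rw [← h]; simp [h0]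
  have hval : ∀ p : triodModel, ∃ i : Fin 3, ∃ t ∈ Icc (0:ℝ) 1, f p = γ i t ∧
      (p : ℝ × ℝ) = (![((t, 0) : ℝ × ℝ), (-t, 0), (0, t)] i) := by
    rintro ⟨⟨x, y⟩, hp⟩
    rcases hp with ⟨hx, hy⟩ | ⟨hx, hy⟩
    · simp only [mem_singleton_iff] at hy
      simp only [mem_Icc] at hx
      subst hy
      by_cases hx0 : 0 ≤ x
      · refine ⟨0, x, ⟨hx0, hx.2⟩, ?_, by simp⟩
        simp only [hf, abs_nonpos_iff, hx0, if_true]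
        split_ifs with h
        · rw [h, h0, h0]
        · rfl
      · refine ⟨1, -x, ⟨by linarith, by linarith⟩, ?_, by simp⟩
        simp only [hf, abs_nonpos_iff, hx0, if_false]
        rw [if_neg (by rintro rfl; exact hx0 le_rfl)]
    · simp only [mem_singleton_iff] at hx
      subst hx
      exact ⟨2, y, hy, by simp [hf, hy.1], by simp⟩
  have hfi : Function.Injective f := by
    intro p q hpq
    obtain ⟨i, s, hs, hfs, hps⟩ := hval p
    obtain ⟨j, t, ht, hft, hqt⟩ := hval q
    apply Subtype.ext
    rw [hfs, hft] at hpq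
    by_cases hij : i = j
    · subst hij
      rw [hps, hqt, hi i hs ht hpq]
    · have e1 := hd i j hij s hs t ht hpq
      have e2 := hd j i (Ne.symm hij) t ht s hs hpq.symm
      rw [hps, hqt, e1, e2]
      fin_cases i <;> fin_cases j <;> simp
  have hcomp : CompactSpace triodModel := by
    refine isCompact_iff_compactSpace.1 ?_
    exact (isCompact_Icc.prod isCompact_singleton).union (isCompact_singleton.prod isCompact_Icc)
  refine ⟨range f, ?_, (hfc.isClosedEmbedding hfi).isEmbedding.toHomeomorph, ?_⟩
  · rintro _ ⟨p, rfl⟩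
    obtain ⟨i, t, ht, h, -⟩ := hval p
    exact mem_iUnion.2 ⟨i, t, ht, h.symm⟩
  · change f _ = z
    simp [hf, h0]

/-- The top of a simple triod is an interior point of some arc in it. -/
lemma IsSimpleTriodWithTop.exists_arc [T2Space X] {T : Set X} {x : X}
    (h : IsSimpleTriodWithTop T x) : ∃ A ⊆ T, IsArc A ∧ x ∈ A ∧ ¬ IsEndpointOfArc A x := by
  obtain ⟨φ, hφ⟩ := h
  have hm : ∀ t : Icc (-1:ℝ) 1, ((t : ℝ), (0:ℝ)) ∈ triodModel := fun t => Or.inl ⟨t.2, rfl⟩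
  set γ : ℝ → X := IccExtend (show (-1:ℝ) ≤ 1 by norm_num) (fun t => ((φ ⟨_, hm t⟩ : T) : X))
    with hγ
  have key : ∀ t (ht : t ∈ Icc (-1:ℝ) 1), γ t = φ ⟨_, hm ⟨t, ht⟩⟩ :=
    fun t ht => IccExtend_of_mem _ _ ht
  have hc : Continuous γ := by
    refine Continuous.Icc_extend' ?_
    exact continuous_subtype_val.comp (φ.continuous.comp (by fun_prop))
  have hi : InjOn γ (Icc (-1) 1) := by
    intro s hs t ht hst
    rw [key s hs, key t ht] at hst
    have := congrArg Subtype.val (φ.injective (Subtype.ext hst))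
    exact congrArg Prod.fst this
  have h0 : γ 0 = x := by rw [key 0 (by norm_num), ← hφ]
  have m0 : (0:ℝ) ∈ Icc (-1:ℝ) 1 := by norm_num
  obtain ⟨ψ, -⟩ := exists_homeo_image (by norm_num) hc.continuousOn hi
  refine ⟨γ '' Icc (-1) 1, ?_, ⟨ψ.symm⟩, ⟨0, m0, h0⟩, fun he => ?_⟩
  · rintro _ ⟨t, ht, rfl⟩
    rw [key t ht]; exact (φ _).2
  · rcases he.eq_or_eq (by norm_num) hc.continuousOn hi with h | h
    · have := hi m0 (by norm_num) (h0.trans h); norm_num at this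
    · have := hi m0 (by norm_num) (h0.trans h); norm_num at this

end Arcs

section Segments
variable {X : Type*} [TopologicalSpace X]

/-- The arc in `L` from `v` to `x`, when there is exactly one. -/
def segTo (L : Set X) (v x : X) : Set X := ⋃₀ {A | A ⊆ L ∧ IsArcFromTo A v x}

lemma IsDendroid.isPreconnected_inter {L A B : Set X} (hL : IsDendroid L) (hA : IsSubcontinuum A)
    (hB : IsSubcontinuum B) (hAL : A ⊆ L) (hBL : B ⊆ L) : IsPreconnected (A ∩ B) := by
  rcases (A ∩ B).eq_empty_or_nonempty with h | h
  · rw [h]; exact isPreconnected_empty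
  · exact (hL.2.2 (A ∪ B) (union_subset hAL hBL) ⟨hA.1.union hB.1, hA.2.union h hB.2⟩ A B hA hB
      rfl).isPreconnected

lemma IsArcFromTo.subset_of_isPreconnected [T2Space X] {A S : Set X} {x y : X}
    (h : IsArcFromTo A x y) (hS : IsPreconnected S) (hSA : S ⊆ A) (hx : x ∈ S) (hy : y ∈ S) :
    A ⊆ S := by
  by_cases hxy : x = y
  · rcases h with h | h
    · rw [h.2]; exact singleton_subset_iff.2 hx
    · exact absurd hxy h.1
  · obtain ⟨γ, hc, hi, rfl, rfl, rfl⟩ := h.exists_param hxy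
    rintro _ ⟨t, ht, rfl⟩
    exact hS.mem_of_param hc.continuousOn hi hSA ⟨le_rfl, zero_le_one⟩ ⟨zero_le_one, le_rfl⟩
      hx hy ht

lemma IsDendroid.arc_unique [T2Space X] {L A B : Set X} {x y : X} (hL : IsDendroid L)
    (hA : IsArcFromTo A x y) (hB : IsArcFromTo B x y) (hAL : A ⊆ L) (hBL : B ⊆ L) : A = B := by
  have h := hL.isPreconnected_inter hA.isSubcontinuum hB.isSubcontinuum hAL hBL
  have hx : x ∈ A ∩ B := ⟨hA.left_mem, hB.left_mem⟩
  have hy : y ∈ A ∩ B := ⟨hA.right_mem, hB.right_mem⟩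
  exact Subset.antisymm
    ((hA.subset_of_isPreconnected h inter_subset_left hx hy).trans inter_subset_right)
    ((hB.subset_of_isPreconnected h inter_subset_right hx hy).trans inter_subset_left)

variable {L : Set X} {v : X}

lemma IsDendroid.eq_segTo [T2Space X] {A : Set X} {x : X} (hL : IsDendroid L) (hAL : A ⊆ L)
    (hA : IsArcFromTo A v x) : segTo L v x = A := by
  refine Subset.antisymm (sUnion_subset ?_) (subset_sUnion_of_mem ⟨hAL, hA⟩)
  rintro B ⟨hBL, hB⟩
  rw [hL.arc_unique hB hA hBL hAL]

lemma IsDendroid.segTo_spec [T2Space X] {x : X} (hL : IsDendroid L) (hv : v ∈ L) (hx : x ∈ L) :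
    segTo L v x ⊆ L ∧ IsArcFromTo (segTo L v x) v x := by
  have : ∃ A ⊆ L, IsArcFromTo A v x := by
    by_cases hvx : v = x
    · exact ⟨{v}, singleton_subset_iff.2 hv, Or.inl ⟨hvx, rfl⟩⟩
    · obtain ⟨A, hAL, h⟩ := hL.2.1 v hv x hx hvx
      exact ⟨A, hAL, Or.inr ⟨hvx, h⟩⟩
  obtain ⟨A, hAL, hA⟩ := this
  rw [hL.eq_segTo hAL hA]
  exact ⟨hAL, hA⟩

lemma IsDendroid.segTo_self [T2Space X] (hL : IsDendroid L) (hv : v ∈ L) :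
    segTo L v v = {v} :=
  hL.eq_segTo (singleton_subset_iff.2 hv) (Or.inl ⟨rfl, rfl⟩)

lemma IsDendroid.exists_segTo_param [T2Space X] {x : X} (hL : IsDendroid L) (hv : v ∈ L)
    (hx : x ∈ L) (hvx : v ≠ x) :
    ∃ γ : ℝ → X, Continuous γ ∧ InjOn γ (Icc 0 1) ∧ γ '' Icc 0 1 = segTo L v x ∧ γ 0 = v ∧
      γ 1 = x ∧ ∀ t ∈ Icc (0:ℝ) 1, segTo L v (γ t) = γ '' Icc 0 t := by
  obtain ⟨hsub, harc⟩ := hL.segTo_spec hv hx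
  obtain ⟨γ, hc, hi, him, h0, h1⟩ := harc.exists_param hvx
  refine ⟨γ, hc, hi, him, h0, h1, fun t ht => ?_⟩
  have hsub' : γ '' Icc 0 t ⊆ L :=
    (image_mono (Icc_subset_Icc_right ht.2)).trans (him.trans_subset hsub)
  refine hL.eq_segTo hsub' ?_
  rcases ht.1.eq_or_lt with rfl | h
  · rw [Icc_self, image_singleton, h0]; exact Or.inl ⟨rfl, rfl⟩
  · have := isArcFromTo_image h hc.continuousOn (hi.mono (Icc_subset_Icc_right ht.2))
    rwa [h0] at this

lemma IsDendroid.segTo_subset [T2Space X] {x y : X} (hL : IsDendroid L) (hv : v ∈ L)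
    (hx : x ∈ L) (hy : y ∈ segTo L v x) : segTo L v y ⊆ segTo L v x := by
  by_cases hvx : v = x
  · subst hvx
    rw [hL.segTo_self hv, mem_singleton_iff] at hy
    rw [hy]
  · obtain ⟨γ, -, -, him, -, -, h⟩ := hL.exists_segTo_param hv hx hvx
    rw [← him] at hy ⊢
    obtain ⟨t, ht, rfl⟩ := hy
    rw [h t ht]
    exact image_mono (Icc_subset_Icc_right ht.2)

lemma IsDendroid.segTo_antisymm [T2Space X] {x y : X} (hL : IsDendroid L) (hv : v ∈ L)
    (hx : x ∈ L) (hy : y ∈ segTo L v x) (hyx : x ∈ segTo L v y) : y = x := by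
  by_cases hvx : v = x
  · subst hvx
    rwa [hL.segTo_self hv, mem_singleton_iff] at hy
  · obtain ⟨γ, -, hi, him, -, h1, h⟩ := hL.exists_segTo_param hv hx hvx
    rw [← him] at hy
    obtain ⟨t, ht, rfl⟩ := hy
    rw [h t ht] at hyx
    obtain ⟨s, hs, hsx⟩ := hyx
    have : s = 1 := hi ⟨hs.1, hs.2.trans ht.2⟩ ⟨zero_le_one, le_rfl⟩ (hsx.trans h1.symm)
    rw [le_antisymm ht.2 (this ▸ hs.2), h1]

/-- A point of `L` other than `v` beyond which no segment extends is an endpoint. -/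
lemma IsDendroid.isEndpoint_of_maximal [T2Space X] {y : X} (hL : IsDendroid L) (hv : v ∈ L)
    (hy : y ∈ L) (hvy : v ≠ y) (hmax : ∀ z ∈ L, y ∈ segTo L v z → z = y) :
    IsEndpoint L y := by
  refine ⟨hy, fun B hBL hB hyB => ?_⟩
  obtain ⟨δ, hδc, hδi, rfl⟩ := hB.exists_param
  obtain ⟨t, ht, rfl⟩ := hyB
  have harc := isArcFromTo_image zero_lt_one hδc.continuousOn hδi
  rcases harc with h | ⟨-, -, h0, h1⟩
  · exact absurd (hδi ⟨le_rfl, zero_le_one⟩ ⟨zero_le_one, le_rfl⟩ h.1) zero_ne_one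
  rcases ht.1.eq_or_lt with rfl | ht0
  · exact h0
  rcases ht.2.eq_or_lt with rfl | ht1
  · exact h1
  exfalso
  obtain ⟨γ, hc, hi, him, hγ0, hγ1, h⟩ := hL.exists_segTo_param hv hy hvy
  have hsegL := (hL.segTo_spec hv hy).1
  -- each half of the arc must overlap the segment in more than the point itself
  have half : ∀ δ' : ℝ → X, Continuous δ' → InjOn δ' (Icc 0 1) → δ' '' Icc 0 1 ⊆ L →
      δ' 0 = δ t → ∃ a ∈ Ico (0:ℝ) 1, γ '' Icc a 1 ⊆ δ' '' Icc 0 1 := by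
    intro δ' hc' hi' hsub' h0'
    have hpre := hL.isPreconnected_inter (isSubcontinuum_image zero_le_one hc.continuousOn)
      (isSubcontinuum_image zero_le_one hc'.continuousOn) (him.trans_subset hsegL) hsub'
    by_cases hex : ∃ a ∈ Ico (0:ℝ) 1, γ a ∈ δ' '' Icc 0 1
    · obtain ⟨a, ha, hmem⟩ := hex
      refine ⟨a, ha, ?_⟩
      rintro _ ⟨u, hu, rfl⟩
      have ha' : a ∈ Icc (0:ℝ) 1 := ⟨ha.1, ha.2.le⟩
      have h1' : (1:ℝ) ∈ Icc (0:ℝ) 1 := ⟨zero_le_one, le_rfl⟩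
      refine (hpre.mem_of_param hc.continuousOn hi inter_subset_left ha' h1'
        ⟨⟨a, ha', rfl⟩, hmem⟩ ⟨⟨1, h1', rfl⟩, 0, ⟨le_rfl, zero_le_one⟩, ?_⟩ hu).2
      rw [h0', hγ1]
    · push Not at hex
      have hcat := exists_arc_concat zero_lt_one zero_lt_one hc hc' hi hi' (hγ1.trans h0'.symm)
        (fun s hs r hr hsr => by
          by_contra hne
          exact hex s ⟨hs.1, lt_of_le_of_ne hs.2 hne⟩ ⟨r, hr, hsr.symm⟩)
      rw [hγ0, him] at hcat
      have hseg := hL.eq_segTo (union_subset hsegL hsub') hcat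
      have hm := hmax (δ' 1) (hsub' ⟨1, ⟨zero_le_one, le_rfl⟩, rfl⟩)
        (hseg ▸ Or.inl (hL.segTo_spec hv hy).2.right_mem)
      rw [← h0'] at hm
      exact absurd (hi' ⟨zero_le_one, le_rfl⟩ ⟨le_rfl, zero_le_one⟩ hm) one_ne_zero
  have hinj1 : InjOn (fun s : ℝ => δ (t + (1 - t) * s)) (Icc 0 1) := by
    intro s hs r hr hsr
    have := hδi ⟨by nlinarith [hs.1], by nlinarith [hs.2]⟩
      ⟨by nlinarith [hr.1], by nlinarith [hr.2]⟩ hsr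
    exact mul_left_cancel₀ (by linarith : (1 - t) ≠ 0) (by linarith)
  have hinj2 : InjOn (fun s : ℝ => δ (t - t * s)) (Icc 0 1) := by
    intro s hs r hr hsr
    have := hδi ⟨by nlinarith [hs.2], by nlinarith [hs.1]⟩
      ⟨by nlinarith [hr.2], by nlinarith [hr.1]⟩ hsr
    exact mul_left_cancel₀ ht0.ne' (by linarith)
  obtain ⟨a, ha, hau⟩ := half (fun s => δ (t + (1 - t) * s)) (by fun_prop) hinj1 (by
    rintro _ ⟨s, hs, rfl⟩
    exact hBL ⟨_, ⟨by nlinarith [hs.1], by nlinarith [hs.2]⟩, rfl⟩) (by simp)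
  obtain ⟨b, hb, hbu⟩ := half (fun s => δ (t - t * s)) (by fun_prop) hinj2 (by
    rintro _ ⟨s, hs, rfl⟩
    exact hBL ⟨_, ⟨by nlinarith [hs.2], by nlinarith [hs.1]⟩, rfl⟩) (by simp)
  have hc1 : max a b < 1 := max_lt ha.2 hb.2
  obtain ⟨s, hs, hsc⟩ := hau ⟨max a b, ⟨le_max_left _ _, hc1.le⟩, rfl⟩
  obtain ⟨r, hr, hrc⟩ := hbu ⟨max a b, ⟨le_max_right _ _, hc1.le⟩, rfl⟩
  simp only at hsc hrc
  have e := hδi ⟨by nlinarith [hs.1], by nlinarith [hs.2]⟩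
    ⟨by nlinarith [hr.2], by nlinarith [hr.1]⟩ (hsc.trans hrc.symm)
  have hs0 : (1 - t) * s = 0 := by nlinarith [hs.1, hr.1]
  rw [hs0, add_zero, ← hγ1] at hsc
  have := hi ⟨zero_le_one, le_rfl⟩ ⟨ha.1.trans (le_max_left a b), hc1.le⟩ hsc
  linarith

/-- No segment extends beyond an endpoint. -/
lemma IsEndpoint.eq_of_mem_segTo [T2Space X] {y z : X} (hy : IsEndpoint L y)
    (hL : IsDendroid L) (hv : v ∈ L) (hvy : v ≠ y) (hz : z ∈ L) (hyz : y ∈ segTo L v z) :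
    z = y := by
  by_cases hvz : v = z
  · subst hvz
    rw [hL.segTo_self hv] at hyz; exact hyz.symm
  · obtain ⟨γ, hc, hi, him, hγ0, hγ1, -⟩ := hL.exists_segTo_param hv hz hvz
    obtain ⟨hsub, h | ⟨-, harc, -⟩⟩ := hL.segTo_spec hv hz
    · exact absurd h.1 hvz
    have := hy.2 _ hsub harc hyz
    rw [← him] at this
    rcases this.eq_or_eq zero_lt_one hc.continuousOn hi with h | h
    · exact absurd (h.trans hγ0).symm hvy
    · rw [h, hγ1]

lemma IsFanWithTop.not_isEndpoint [T2Space X] (hL : IsFanWithTop L v) : ¬ IsEndpoint L v := by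
  intro h
  obtain ⟨-, T, hTL, hT⟩ := hL.2
  obtain ⟨A, hAT, hA, hvA, hne⟩ := hT.exists_arc
  exact hne (h.2 A (hAT.trans hTL) hA hvA)

end Segments

section Height
variable {X : Type*} [MetricSpace X] {L : Set X} {v : X}

lemma IsSmoothFan.tendsto_segTo (hS : IsSmoothFan L v) {x : X} {xs : ℕ → X} (hx : x ∈ L)
    (hxs : ∀ n, xs n ∈ L) (hlim : Tendsto xs atTop (𝓝 x)) :
    Tendsto (fun n => Metric.hausdorffDist (segTo L v (xs n)) (segTo L v x)) atTop (𝓝 0) := by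
  have hL := hS.1.1.1
  have hv := hS.1.2.1
  obtain ⟨h1, h2⟩ := hL.segTo_spec hv hx
  exact hS.2 x hx xs hxs hlim _ h1 h2 _ fun n => hL.segTo_spec hv (hxs n)

lemma IsDendroid.isCompact_segTo {x : X} (hL : IsDendroid L) (hv : v ∈ L) (hx : x ∈ L) :
    IsCompact (segTo L v x) := (hL.segTo_spec hv hx).2.isSubcontinuum.1

lemma IsDendroid.left_mem_segTo {x : X} (hL : IsDendroid L) (hv : v ∈ L) (hx : x ∈ L) :
    v ∈ segTo L v x := (hL.segTo_spec hv hx).2.left_mem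

lemma IsDendroid.right_mem_segTo {x : X} (hL : IsDendroid L) (hv : v ∈ L) (hx : x ∈ L) :
    x ∈ segTo L v x := (hL.segTo_spec hv hx).2.right_mem

lemma IsDendroid.hausdorffEDist_segTo_ne_top {x y : X} (hL : IsDendroid L) (hv : v ∈ L)
    (hx : x ∈ L) (hy : y ∈ L) :
    Metric.hausdorffEDist (segTo L v x) (segTo L v y) ≠ ⊤ :=
  Metric.hausdorffEDist_ne_top_of_nonempty_of_bounded ⟨v, hL.left_mem_segTo hv hx⟩
    ⟨v, hL.left_mem_segTo hv hy⟩ (hL.isCompact_segTo hv hx).isBounded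
    (hL.isCompact_segTo hv hy).isBounded

lemma IsSmoothFan.isCompact_segTo_rel (hS : IsSmoothFan L v) :
    IsCompact {p : X × X | p.1 ∈ L ∧ p.2 ∈ segTo L v p.1} := by
  have hL := hS.1.1.1
  have hv := hS.1.2.1
  have hLc := hL.1.1
  refine (hLc.prod hLc).of_isClosed_subset (IsSeqClosed.isClosed ?_)
    fun p hp => ⟨hp.1, (hL.segTo_spec hv hp.1).1 hp.2⟩
  rintro p ⟨x, y⟩ hp hlim
  have hx := (continuous_fst.tendsto _).comp hlim
  have hy := (continuous_snd.tendsto _).comp hlim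
  simp only at hx hy
  have hxL : x ∈ L := hLc.isClosed.mem_of_tendsto hx (Eventually.of_forall fun n => (hp n).1)
  refine ⟨hxL, ?_⟩
  have hcl := (hL.isCompact_segTo hv hxL).isClosed
  have hne : (segTo L v x).Nonempty := ⟨v, hL.left_mem_segTo hv hxL⟩
  refine (hcl.mem_iff_infDist_zero hne).2 (le_antisymm ?_ Metric.infDist_nonneg)
  have h1 := hS.tendsto_segTo hxL (fun n => (hp n).1) hx
  have h2 := ((tendsto_const_nhds (x := y)).dist hy).add h1
  rw [dist_self, add_zero] at h2
  refine ge_of_tendsto h2 (Eventually.of_forall fun n => ?_)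
  have a1 : Metric.infDist y (segTo L v x) ≤
      Metric.infDist (p n).2 (segTo L v x) + dist y (p n).2 := Metric.infDist_le_infDist_add_dist
  have a2 := Metric.infDist_le_hausdorffDist_of_mem (hp n).2
    (hL.hausdorffEDist_segTo_ne_top hv (hp n).1 hxL)
  simp only [Function.comp] at *
  linarith

/-- A continuous function on `L` which is strictly increasing along the segments from `v`. -/
structure IsHeight (L : Set X) (v : X) (μ : X → ℝ) : Prop where
  continuousOn : ContinuousOn μ L
  map_top : μ v = 0
  lt_of_mem : ∀ x ∈ L, ∀ y ∈ segTo L v x, y ≠ x → μ y < μ x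

lemma IsSmoothFan.exists_height (hS : IsSmoothFan L v) :
    ∃ μ : X → ℝ, IsHeight L v μ := by
  have hL := hS.1.1.1
  have hv := hS.1.2.1
  have hLc := hL.1.1
  have : CompactSpace L := isCompact_iff_compactSpace.1 hLc
  have : Nonempty L := ⟨⟨v, hv⟩⟩
  set d : ℕ → X := fun k => (TopologicalSpace.denseSeq L k : L) with hd
  have hdL : ∀ k, d k ∈ L := fun k => (TopologicalSpace.denseSeq L k).2
  have hdense : ∀ x ∈ L, ∀ ε > 0, ∃ k, dist x (d k) < ε := by
    intro x hx ε hε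
    obtain ⟨k, hk⟩ := (TopologicalSpace.denseRange_denseSeq L).exists_mem_open
      (Metric.isOpen_ball (x := (⟨x, hx⟩ : L)) (ε := ε)) ⟨_, Metric.mem_ball_self hε⟩
    exact ⟨k, by rw [dist_comm]; exact hk⟩
  set f : ℕ → X → ℝ := fun k x =>
    (1 / 2 : ℝ) ^ k * (dist (d k) v - Metric.infDist (d k) (segTo L v x)) with hf
  have hbound : ∀ k, ∀ x ∈ L, ‖f k x‖ ≤ (1 / 2 : ℝ) ^ k * Metric.diam L := by
    intro k x hx
    have h1 := Metric.infDist_le_dist_of_mem (x := d k) (hL.left_mem_segTo hv hx)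
    have h2 := Metric.dist_le_diam_of_mem hLc.isBounded (hdL k) hv
    have h3 := Metric.infDist_nonneg (x := d k) (s := segTo L v x)
    rw [Real.norm_eq_abs, abs_of_nonneg (mul_nonneg (by positivity) (by linarith))]
    exact mul_le_mul_of_nonneg_left (by linarith) (by positivity)
  have hsum : Summable fun k : ℕ => (1 / 2 : ℝ) ^ k * Metric.diam L :=
    summable_geometric_two.mul_right _
  have hfs : ∀ x ∈ L, Summable fun k => f k x := fun x hx =>
    Summable.of_norm_bounded hsum fun k => hbound k x hx
  refine ⟨fun x => ∑' k, f k x, continuousOn_tsum (fun k => ?_) hsum hbound, ?_, ?_⟩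
  · refine continuousOn_const.mul (continuousOn_const.sub ?_)
    rw [continuousOn_iff_continuous_domRestrict, continuous_iff_seqContinuous]
    intro xs x hlim
    have hlim' := (continuous_subtype_val.tendsto x).comp hlim
    have h0 := hS.tendsto_segTo x.2 (fun n => (xs n).2) hlim'
    refine tendsto_iff_dist_tendsto_zero.2 (squeeze_zero (fun _ => dist_nonneg) (fun n => ?_) h0)
    rw [Real.dist_eq, abs_sub_le_iff]
    have hne := hL.hausdorffEDist_segTo_ne_top hv (xs n).2 x.2
    have a1 := Metric.infDist_le_infDist_add_hausdorffDist (x := d k) hne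
    rw [Metric.hausdorffEDist_comm] at hne
    have a2 := Metric.infDist_le_infDist_add_hausdorffDist (x := d k) hne
    rw [Metric.hausdorffDist_comm] at a2
    simp only [Function.comp, domRestrict_apply] at *
    constructor <;> linarith
  · simp [hf, hL.segTo_self hv, Metric.infDist_singleton]
  · intro x hx y hy hyx
    have hyL := (hL.segTo_spec hv hx).1 hy
    have hsub := hL.segTo_subset hv hx hy
    have hnot : x ∉ segTo L v y := fun h => hyx (hL.segTo_antisymm hv hx hy h)
    have hcl := (hL.isCompact_segTo hv hyL).isClosed
    have hne : (segTo L v y).Nonempty := ⟨v, hL.left_mem_segTo hv hyL⟩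
    have hpos : 0 < Metric.infDist x (segTo L v y) :=
      lt_of_le_of_ne Metric.infDist_nonneg fun h => hnot ((hcl.mem_iff_infDist_zero hne).2 h.symm)
    obtain ⟨k, hk⟩ := hdense x hx _ (half_pos hpos)
    refine Summable.tsum_lt_tsum (i := k) (fun j => ?_) ?_ (hfs y hyL) (hfs x hx)
    · exact mul_le_mul_of_nonneg_left
        (sub_le_sub_left (Metric.infDist_le_infDist_of_subset hsub hne) _) (by positivity)
    · refine mul_lt_mul_of_pos_left (sub_lt_sub_left ?_ _) (by positivity)
      have a1 := Metric.infDist_le_dist_of_mem (x := d k) (hL.right_mem_segTo hv hx)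
      have a2 := Metric.infDist_le_infDist_add_dist (x := x) (y := d k) (s := segTo L v y)
      rw [dist_comm] at a1
      linarith

end Height

section FanStructure
variable {X : Type*}

lemma IsDendroid.segTo_total [TopologicalSpace X] [T2Space X] {L : Set X} {v x y z : X}
    (hL : IsDendroid L) (hv : v ∈ L) (hx : x ∈ L) (hy : y ∈ segTo L v x) (hz : z ∈ segTo L v x) :
    y ∈ segTo L v z ∨ z ∈ segTo L v y := by
  by_cases hvx : v = x
  · subst hvx
    rw [hL.segTo_self hv, mem_singleton_iff] at hy hz
    subst hy
    subst hz
    exact Or.inl (hL.segTo_spec hv hv).2.left_mem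
  · obtain ⟨γ, -, -, him, -, -, h⟩ := hL.exists_segTo_param hv hx hvx
    rw [← him] at hy hz
    obtain ⟨s, hs, rfl⟩ := hy
    obtain ⟨t, ht, rfl⟩ := hz
    rw [h s hs, h t ht]
    rcases le_total s t with hst | hst
    · exact Or.inl ⟨s, ⟨hs.1, hst⟩, rfl⟩
    · exact Or.inr ⟨t, ⟨ht.1, hst⟩, rfl⟩

/-- Reparametrization of a subarc. -/
lemma injOn_affine {γ : ℝ → X} {a b : ℝ} (hγ : InjOn γ (Icc 0 1)) (ha : a ∈ Icc (0:ℝ) 1)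
    (hb : b ∈ Icc (0:ℝ) 1) (hab : a ≠ b) : InjOn (fun s => γ (a + (b - a) * s)) (Icc 0 1) := by
  have hmem : ∀ s ∈ Icc (0:ℝ) 1, a + (b - a) * s ∈ Icc (0:ℝ) 1 := fun s hs =>
    ⟨by nlinarith [hs.1, hs.2, ha.1, hb.1], by nlinarith [hs.1, hs.2, ha.2, hb.2]⟩
  intro s hs r hr hsr
  have := hγ (hmem s hs) (hmem r hr) hsr
  exact mul_left_cancel₀ (sub_ne_zero.2 hab.symm) (add_left_cancel this)

variable [MetricSpace X] {L : Set X} {v : X} {μ : X → ℝ}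

lemma IsHeight.le_of_mem (hμ : IsHeight L v μ) {x y : X} (hx : x ∈ L) (hy : y ∈ segTo L v x) :
    μ y ≤ μ x := by
  rcases eq_or_ne y x with rfl | h
  · exact le_rfl
  · exact (hμ.lt_of_mem x hx y hy h).le

lemma IsHeight.eq_of_mem (hμ : IsHeight L v μ) {x y : X} (hx : x ∈ L) (hy : y ∈ segTo L v x)
    (h : μ x ≤ μ y) : y = x := by
  by_contra hne
  exact absurd (hμ.lt_of_mem x hx y hy hne) (not_lt.2 h)

lemma IsHeight.injOn_segTo (hμ : IsHeight L v μ) (hL : IsDendroid L) (hv : v ∈ L) {x : X}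
    (hx : x ∈ L) : InjOn μ (segTo L v x) := by
  intro y hy z hz hyz
  have hsub := (hL.segTo_spec hv hx).1
  rcases hL.segTo_total hv hx hy hz with h | h
  · exact hμ.eq_of_mem (hsub hz) h hyz.ge
  · exact (hμ.eq_of_mem (hsub hy) h hyz.le).symm

lemma IsHeight.pos (hμ : IsHeight L v μ) (hL : IsDendroid L) (hv : v ∈ L) {x : X}
    (hx : x ∈ L) (hvx : v ≠ x) : 0 < μ x :=
  hμ.map_top ▸ hμ.lt_of_mem x hx v (hL.left_mem_segTo hv hx) hvx

lemma IsHeight.nonneg (hμ : IsHeight L v μ) (hL : IsDendroid L) (hv : v ∈ L) {x : X}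
    (hx : x ∈ L) : 0 ≤ μ x :=
  hμ.map_top ▸ hμ.le_of_mem hx (hL.left_mem_segTo hv hx)

lemma IsHeight.exists_mem_eq (hμ : IsHeight L v μ) (hL : IsDendroid L) (hv : v ∈ L) {x : X}
    (hx : x ∈ L) {c : ℝ} (hc : c ∈ Icc 0 (μ x)) : ∃ y ∈ segTo L v x, μ y = c := by
  obtain ⟨hsub, harc⟩ := hL.segTo_spec hv hx
  exact harc.isSubcontinuum.2.isPreconnected.intermediate_value harc.left_mem harc.right_mem
    (hμ.continuousOn.mono hsub) (hμ.map_top ▸ hc)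

lemma IsHeight.exists_isEndpoint (hμ : IsHeight L v μ) (hS : IsSmoothFan L v) {x : X}
    (hx : x ∈ L) (hvx : v ≠ x) : ∃ e, IsEndpoint L e ∧ x ∈ segTo L v e := by
  have hL := hS.1.1.1
  have hv := hS.1.2.1
  have hc : IsCompact (Prod.fst '' ({p : X × X | p.1 ∈ L ∧ p.2 ∈ segTo L v p.1} ∩
      Prod.snd ⁻¹' {x})) :=
    (hS.isCompact_segTo_rel.inter_right (isClosed_singleton.preimage continuous_snd)).image
      continuous_fst
  have hsub : Prod.fst '' ({p : X × X | p.1 ∈ L ∧ p.2 ∈ segTo L v p.1} ∩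
      Prod.snd ⁻¹' {x}) ⊆ L := by rintro _ ⟨p, hp, rfl⟩; exact hp.1.1
  obtain ⟨_, ⟨⟨e, y⟩, ⟨⟨he, hxe⟩, hyx⟩, rfl⟩, hmax⟩ := hc.exists_isMaxOn
    ⟨x, (x, x), ⟨⟨hx, hL.right_mem_segTo hv hx⟩, rfl⟩, rfl⟩ (hμ.continuousOn.mono hsub)
  simp only [mem_preimage, mem_singleton_iff] at hyx he hxe
  subst hyx
  have hve : v ≠ e := by
    rintro rfl
    rw [hL.segTo_self hv, mem_singleton_iff] at hxe
    exact hvx hxe.symm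
  refine ⟨e, hL.isEndpoint_of_maximal hv he hve fun z hz hez => ?_, hxe⟩
  have hyz := hL.segTo_subset hv hz hez hxe
  exact (hμ.eq_of_mem hz hez (hmax ⟨(z, y), ⟨⟨hz, hyz⟩, rfl⟩, rfl⟩)).symm

lemma IsFanWithTop.ne_of_isEndpoint (hF : IsFanWithTop L v) {e : X} (he : IsEndpoint L e) :
    v ≠ e := by
  rintro rfl
  exact hF.not_isEndpoint he

lemma IsHeight.segTo_inter_segTo (hμ : IsHeight L v μ) (hF : IsFanWithTop L v) {e e' : X}
    (he : IsEndpoint L e) (he' : IsEndpoint L e') (hne : e ≠ e') :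
    segTo L v e ∩ segTo L v e' = {v} := by
  have hL := hF.1.1
  have hv := hF.2.1
  have hve := hF.ne_of_isEndpoint he
  have hve' := hF.ne_of_isEndpoint he'
  have hsub := (hL.segTo_spec hv he.1).1
  refine Subset.antisymm (fun w hw => ?_)
    (singleton_subset_iff.2 ⟨hL.left_mem_segTo hv he.1, hL.left_mem_segTo hv he'.1⟩)
  obtain ⟨z, ⟨hz, hz'⟩, hmax⟩ := ((hL.isCompact_segTo hv he.1).inter
    (hL.isCompact_segTo hv he'.1)).exists_isMaxOn ⟨w, hw⟩
    (hμ.continuousOn.mono (inter_subset_left.trans hsub))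
  suffices hzv : z = v by
    by_contra hwv
    have h1 := hμ.pos hL hv (hsub hw.1) (Ne.symm hwv)
    have h2 : μ w ≤ μ z := hmax hw
    rw [hzv, hμ.map_top] at h2
    linarith
  by_contra hzv
  obtain ⟨γ, hc, hi, him, hγ0, hγ1, hγ⟩ := hL.exists_segTo_param hv he.1 hve
  obtain ⟨γ', hc', hi', him', hγ0', hγ1', hγ'⟩ := hL.exists_segTo_param hv he'.1 hve'
  obtain ⟨s, hs, hsz⟩ : z ∈ γ '' Icc 0 1 := him ▸ hz
  obtain ⟨s', hs', hsz'⟩ : z ∈ γ' '' Icc 0 1 := him' ▸ hz'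
  have hs0 : s ≠ 0 := by rintro rfl; exact hzv (hsz ▸ hγ0)
  have hs1 : s ≠ 1 := by
    rintro rfl
    rw [← hsz, hγ1] at hz'
    exact hne (he.eq_of_mem_segTo hL hv hve he'.1 hz').symm
  have hs1' : s' ≠ 1 := by
    rintro rfl
    rw [← hsz', hγ1'] at hz
    exact hne (he'.eq_of_mem_segTo hL hv hve' he.1 hz)
  have m0 : (0:ℝ) ∈ Icc (0:ℝ) 1 := ⟨le_rfl, zero_le_one⟩
  have m1 : (1:ℝ) ∈ Icc (0:ℝ) 1 := ⟨zero_le_one, le_rfl⟩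
  -- points of the two outer arcs lie beyond `z`
  have hin : ∀ r ∈ Icc (0:ℝ) 1, γ (s + (0 - s) * r) ∈ segTo L v z := fun r hr => by
    rw [← hsz, hγ s hs]
    exact ⟨_, ⟨by nlinarith [hs.1, hr.2], by nlinarith [hs.1, hr.1]⟩, rfl⟩
  have hout : ∀ r ∈ Icc (0:ℝ) 1, γ (s + (1 - s) * r) ∈ segTo L v e ∧
      z ∈ segTo L v (γ (s + (1 - s) * r)) := fun r hr => by
    have hm : s + (1 - s) * r ∈ Icc (0:ℝ) 1 :=
      ⟨by nlinarith [hs.1, hs.2, hr.1, hr.2], by nlinarith [hs.1, hs.2, hr.1, hr.2]⟩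
    refine ⟨him ▸ ⟨_, hm, rfl⟩, ?_⟩
    rw [hγ _ hm]
    exact ⟨s, ⟨hs.1, by nlinarith [hs.2, hr.1]⟩, hsz⟩
  have hout' : ∀ r ∈ Icc (0:ℝ) 1, γ' (s' + (1 - s') * r) ∈ segTo L v e' ∧
      z ∈ segTo L v (γ' (s' + (1 - s') * r)) := fun r hr => by
    have hm : s' + (1 - s') * r ∈ Icc (0:ℝ) 1 :=
      ⟨by nlinarith [hs'.1, hs'.2, hr.1, hr.2], by nlinarith [hs'.1, hs'.2, hr.1, hr.2]⟩
    refine ⟨him' ▸ ⟨_, hm, rfl⟩, ?_⟩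
    rw [hγ' _ hm]
    exact ⟨s', ⟨hs'.1, by nlinarith [hs'.2, hr.1]⟩, hsz'⟩
  have hsub' := (hL.segTo_spec hv he'.1).1
  have hzL := hsub hz
  set η : Fin 3 → ℝ → X := ![fun r => γ (s + (0 - s) * r), fun r => γ (s + (1 - s) * r),
    fun r => γ' (s' + (1 - s') * r)] with hη
  have hηc : ∀ i, Continuous (η i) := by
    intro i; fin_cases i <;> simp only [hη] <;>
      [exact hc.comp (by fun_prop); exact hc.comp (by fun_prop); exact hc'.comp (by fun_prop)]
  have hηi : ∀ i, InjOn (η i) (Icc 0 1) := by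
    intro i; fin_cases i
    exacts [injOn_affine hi hs m0 hs0, injOn_affine hi hs m1 hs1, injOn_affine hi' hs' m1 hs1']
  have hη0 : ∀ i, η i 0 = z := by
    intro i; fin_cases i <;> simp [hη, hsz, hsz']
  have hmeet : ∀ i j, i ≠ j → ∀ a ∈ Icc (0:ℝ) 1, ∀ b ∈ Icc (0:ℝ) 1, η i a = η j b →
      η i a = z := by
    have k01 : ∀ a ∈ Icc (0:ℝ) 1, ∀ b ∈ Icc (0:ℝ) 1, η 0 a = η 1 b → η 0 a = z := by
      intro a ha b hb hab
      refine hL.segTo_antisymm hv hzL (hin a ha) ?_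
      have := (hout b hb).2
      rwa [show γ (s + (1 - s) * b) = η 0 a from hab.symm] at this
    have k02 : ∀ a ∈ Icc (0:ℝ) 1, ∀ b ∈ Icc (0:ℝ) 1, η 0 a = η 2 b → η 0 a = z := by
      intro a ha b hb hab
      refine hL.segTo_antisymm hv hzL (hin a ha) ?_
      have := (hout' b hb).2
      rwa [show γ' (s' + (1 - s') * b) = η 0 a from hab.symm] at this
    have k12 : ∀ a ∈ Icc (0:ℝ) 1, ∀ b ∈ Icc (0:ℝ) 1, η 1 a = η 2 b → η 1 a = z := by
      intro a ha b hb hab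
      have h1 : η 1 a ∈ segTo L v e := (hout a ha).1
      have h2 : η 1 a ∈ segTo L v e' := hab ▸ (hout' b hb).1
      exact (hμ.eq_of_mem (hsub h1) (hout a ha).2 (hmax ⟨h1, h2⟩)).symm
    intro i j hij a ha b hb hab
    fin_cases i <;> fin_cases j
    · exact absurd rfl hij
    · exact k01 a ha b hb hab
    · exact k02 a ha b hb hab
    · exact hab.trans (k01 b hb a ha hab.symm)
    · exact absurd rfl hij
    · exact k12 a ha b hb hab
    · exact hab.trans (k02 b hb a ha hab.symm)
    · exact hab.trans (k12 b hb a ha hab.symm)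
    · exact absurd rfl hij
  obtain ⟨T, hT, hTz⟩ := exists_triod hηc hηi hη0 fun i j hij a ha b hb hab =>
    hηi i ha m0 ((hmeet i j hij a ha b hb hab).trans (hη0 i).symm)
  refine hzv (hF.1.2 z v ⟨hzL, T, hT.trans (iUnion_subset fun i => ?_), hTz⟩ hF.2)
  rintro _ ⟨r, hr, rfl⟩
  fin_cases i
  · exact hsub (hL.segTo_subset hv he.1 hz (hin r hr))
  · exact hsub (hout r hr).1
  · exact hsub' (hout' r hr).1

end FanStructure

section CantorPartition

/-- The Cantor set is homeomorphic to its square. -/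
def cantorPair : (ℕ → Bool) × (ℕ → Bool) ≃ₜ (ℕ → Bool) :=
  Homeomorph.sumArrowHomeomorphProdArrow.symm.trans
    (Homeomorph.piCongrLeft (Y := fun _ => Bool) Equiv.natSumNatEquivNat)

/-- The characteristic sequence of a single natural number. -/
def spike (n : ℕ) : ℕ → Bool := fun k => decide (k = n)

lemma spike_injective : Function.Injective spike := by
  intro m n h
  have := congrFun h m
  simpa [spike] using this

lemma tendsto_spike : Tendsto spike atTop (𝓝 fun _ => false) := by
  rw [tendsto_pi_nhds]
  intro k
  refine tendsto_const_nhds.congr' ?_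
  filter_upwards [eventually_gt_atTop k] with n hn
  simp [spike, hn.ne]

lemma eventually_eq_prefix (s : ℕ → Bool) (n : ℕ) : ∀ᶠ s' in 𝓝 s, ∀ i < n, s' i = s i := by
  have : ∀ i ∈ Finset.range n, ∀ᶠ s' in 𝓝 s, s' i = s i := fun i _ =>
    (continuous_apply i).continuousAt.eventually_mem ((isOpen_discrete {s i}).mem_nhds rfl)
  filter_upwards [(Finset.eventually_all _).2 this] with s' hs' i hi
  exact hs' i (Finset.mem_range.2 hi)

/-- A sequence of disjoint Cantor sets shrinking to a point, together with this point, is a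
Cantor set. -/
lemma exists_cantor_insert {E : Type*} [TopologicalSpace E] {x : E} {q : ℕ → (ℕ → Bool) → E}
    (hc : ∀ n, Continuous (q n)) (hi : ∀ m n s t, q m s = q n t → m = n ∧ s = t)
    (hx : ∀ n s, q n s ≠ x) (hlim : ∀ U ∈ 𝓝 x, ∀ᶠ n in atTop, range (q n) ⊆ U) :
    ∃ h : (ℕ → Bool) → E, Continuous h ∧ Function.Injective h ∧
      range h = insert x (⋃ n, range (q n)) := by
  classical
  set h : (ℕ → Bool) → E := fun s => if H : ∃ n, s n = true then
    q (Nat.find H) (fun k => s (Nat.find H + 1 + k)) else x with hh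
  have h0 : h (fun _ => false) = x := by simp [hh]
  have h1 : ∀ s n, s n = true → (∀ i < n, s i = false) → h s = q n (fun k => s (n + 1 + k)) := by
    intro s n hn hlt
    have H : ∃ n, s n = true := ⟨n, hn⟩
    have : Nat.find H = n := (Nat.find_eq_iff H).2 ⟨hn, fun i hin => by simp [hlt i hin]⟩
    simp only [hh, dif_pos H, this]
  have hcase : ∀ s : ℕ → Bool, (s = fun _ => false) ∨
      ∃ n, s n = true ∧ ∀ i < n, s i = false := by
    intro s
    by_cases H : ∃ n, s n = true
    · exact Or.inr ⟨Nat.find H, Nat.find_spec H, fun i hi => by simpa using Nat.find_min H hi⟩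
    · push Not at H
      exact Or.inl (funext fun n => by simpa using H n)
  refine ⟨h, continuous_iff_continuousAt.2 fun s => ?_, fun s t hst => ?_, ?_⟩
  · rcases hcase s with rfl | ⟨n, hn, hlt⟩
    · intro U hU
      rw [h0] at hU
      obtain ⟨N, hN⟩ := eventually_atTop.1 (hlim U hU)
      rw [mem_map]
      filter_upwards [eventually_eq_prefix (fun _ => false) N] with s' hs'
      rcases hcase s' with rfl | ⟨n, hn, hlt⟩
      · exact mem_preimage.2 (h0 ▸ mem_of_mem_nhds hU)
      · refine hN n (not_lt.1 fun hnN => ?_) (mem_preimage.2 (h1 s' n hn hlt ▸ mem_range_self _))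
        simp [hs' n hnN] at hn
    · have : ContinuousAt (fun s : ℕ → Bool => q n (fun k => s (n + 1 + k))) s :=
        ((hc n).comp (by fun_prop)).continuousAt
      refine this.congr ?_
      filter_upwards [eventually_eq_prefix s (n + 1)] with s' hs'
      refine (h1 s' n (by rw [hs' n n.lt_succ_self, hn]) fun i hin => ?_).symm
      rw [hs' i (hin.trans n.lt_succ_self), hlt i hin]
  · rcases hcase s with rfl | ⟨n, hn, hlt⟩ <;> rcases hcase t with rfl | ⟨m, hm, hlt'⟩
    · rfl
    · rw [h0, h1 t m hm hlt'] at hst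
      exact absurd hst.symm (hx _ _)
    · rw [h0, h1 s n hn hlt] at hst
      exact absurd hst (hx _ _)
    · rw [h1 s n hn hlt, h1 t m hm hlt'] at hst
      obtain ⟨rfl, htail⟩ := hi _ _ _ _ hst
      funext k
      rcases lt_trichotomy k n with hk | rfl | hk
      · rw [hlt k hk, hlt' k hk]
      · rw [hn, hm]
      · have := congrFun htail (k - (n + 1))
        simpa [show n + 1 + (k - (n + 1)) = k by omega] using this
  · ext y
    constructor
    · rintro ⟨s, rfl⟩
      rcases hcase s with rfl | ⟨n, hn, hlt⟩
      · exact Or.inl h0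
      · exact Or.inr (mem_iUnion.2 ⟨n, _, (h1 s n hn hlt).symm⟩)
    · rintro (rfl | hy)
      · exact ⟨_, h0⟩
      · obtain ⟨n, s, rfl⟩ := mem_iUnion.1 hy
        refine ⟨fun k => if k < n then false else if k = n then true else s (k - (n + 1)), ?_⟩
        rw [h1 _ n (by simp) (fun i hi => by simp [hi])]
        congr 1
        funext k
        simp [show ¬ n + 1 + k < n by omega, show n + 1 + k ≠ n by omega]

variable {E : Type*} [TopologicalSpace E] [PolishSpace E] [PerfectSpace E]

lemma exists_cantor_subset {U : Set E} (hU : IsOpen U) (hne : U.Nonempty) :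
    ∃ f : (ℕ → Bool) → E, Continuous f ∧ Function.Injective f ∧ range f ⊆ U := by
  let _ := TopologicalSpace.upgradeIsCompletelyMetrizable E
  obtain ⟨x, hx⟩ := hne
  obtain ⟨V, hV, hVc, hVU⟩ := exists_mem_nhds_isClosed_subset (hU.mem_nhds hx)
  have hsub : closure (interior V) ⊆ U := (closure_minimal interior_subset hVc).trans hVU
  obtain ⟨f, hf, hfc, hfi⟩ := (isOpen_interior (s := V)).perfect_closure.exists_nat_bool_injection
    ⟨x, subset_closure (mem_interior_iff_mem_nhds.2 hV)⟩
  exact ⟨f, hfc, hfi, hf.trans hsub⟩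

lemma exists_cantor_subset_interior_eq_empty {U : Set E} (hU : IsOpen U) (hne : U.Nonempty) :
    ∃ f : (ℕ → Bool) → E, Continuous f ∧ Function.Injective f ∧ range f ⊆ U ∧
      interior (range f) = ∅ := by
  obtain ⟨f, hfc, hfi, hf⟩ := exists_cantor_subset hU hne
  refine ⟨fun s => f (cantorPair (s, fun _ => false)), hfc.comp (by fun_prop), ?_, ?_, ?_⟩
  · intro s t hst
    simpa using cantorPair.injective (hfi hst)
  · rintro _ ⟨s, rfl⟩
    exact hf (mem_range_self _)
  · rw [eq_empty_iff_forall_notMem]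
    intro y hy
    obtain ⟨s, rfl⟩ := interior_subset hy
    have hc : Continuous fun t => f (cantorPair (s, t)) := hfc.comp (by fun_prop)
    have hev : ∀ᶠ n in atTop, f (cantorPair (s, spike n)) ∈
        interior (range fun s => f (cantorPair (s, fun _ => false))) :=
      ((hc.tendsto _).comp tendsto_spike).eventually (isOpen_interior.mem_nhds hy)
    obtain ⟨n, hn⟩ := hev.exists
    obtain ⟨s', hs'⟩ := interior_subset hn
    have := congrFun (congrArg Prod.snd (cantorPair.injective (hfi hs'))) n
    simp [spike] at this

/-- Every sequence of nonempty open sets contains pairwise disjoint Cantor sets. -/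
lemma exists_disjoint_cantor_subset {b : ℕ → Set E} (hb : ∀ n, IsOpen (b n))
    (hne : ∀ n, (b n).Nonempty) :
    ∃ p : ℕ → (ℕ → Bool) → E, (∀ n, Continuous (p n)) ∧ (∀ n, range (p n) ⊆ b n) ∧
      ∀ m n s t, p m s = p n t → m = n ∧ s = t := by
  have step : ∀ (n : ℕ) (F : {F : Set E // IsClosed F ∧ interior F = ∅}),
      ∃ f : (ℕ → Bool) → E, Continuous f ∧ Function.Injective f ∧ range f ⊆ b n \ F.1 ∧
        interior (range f) = ∅ := by
    rintro n ⟨F, hF, hF'⟩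
    refine exists_cantor_subset_interior_eq_empty ((hb n).sdiff hF) ?_
    by_contra hcon
    rw [not_nonempty_iff_eq_empty, sdiff_eq_empty] at hcon
    have := interior_maximal hcon (hb n)
    rw [hF'] at this
    exact (hne n).ne_empty (subset_empty_iff.1 this)
  choose f hfc hfi hfs hfe using step
  let Fs : ℕ → {F : Set E // IsClosed F ∧ interior F = ∅} := fun n =>
    Nat.rec ⟨∅, isClosed_empty, interior_empty⟩ (fun n F => ⟨F.1 ∪ range (f n F),
      F.2.1.union (isCompact_range (hfc n F)).isClosed, by
        rw [interior_union_isClosed_of_interior_empty F.2.1 (hfe n F), F.2.2]⟩) n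
  have hsucc : ∀ n, (Fs (n + 1)).1 = (Fs n).1 ∪ range (f n (Fs n)) := fun n => rfl
  have hmono : Monotone fun n => (Fs n).1 :=
    monotone_nat_of_le_succ fun n => hsucc n ▸ subset_union_left
  have hlt : ∀ m n s t, m < n → f m (Fs m) s ≠ f n (Fs n) t := by
    intro m n s t hmn h
    refine (hfs n (Fs n) (mem_range_self t)).2 (hmono (Nat.succ_le_of_lt hmn) ?_)
    change _ ∈ (Fs (m + 1)).1
    rw [hsucc, ← h]
    exact Or.inr (mem_range_self s)
  refine ⟨fun n => f n (Fs n), fun n => hfc _ _, fun n => (hfs _ _).trans sdiff_subset, ?_⟩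
  intro m n s t h
  rcases lt_trichotomy m n with hmn | rfl | hmn
  · exact absurd h (hlt _ _ _ _ hmn)
  · exact ⟨rfl, hfi _ _ h⟩
  · exact absurd h.symm (hlt _ _ _ _ hmn)

/-- A nonempty perfect Polish space can be partitioned into Cantor sets, as many as it has
points. -/
theorem exists_cantor_partition [Nonempty E] :
    ∃ g : E → (ℕ → Bool) → E, (∀ e, Continuous (g e)) ∧
      (∀ e e' s s', g e s = g e' s' → e = e' ∧ s = s') ∧ ∀ y, ∃ e s, g e s = y := by
  classical
  obtain ⟨b, hb⟩ := (TopologicalSpace.countable_countableBasis E).exists_eq_range (by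
    obtain ⟨x⟩ := ‹Nonempty E›
    obtain ⟨V, hV, -⟩ := (TopologicalSpace.isBasis_countableBasis E).exists_subset_of_mem_open
      (mem_univ x) isOpen_univ
    exact ⟨V, hV⟩)
  have hbasis := TopologicalSpace.isBasis_countableBasis E
  have hbmem : ∀ n, b n ∈ TopologicalSpace.countableBasis E := fun n => hb ▸ mem_range_self n
  have hsmall : ∀ (x : E), ∀ U ∈ 𝓝 x, ∃ n, x ∈ b n ∧ b n ⊆ U := by
    intro x U hU
    obtain ⟨V, hV, hxV, hVU⟩ := hbasis.mem_nhds_iff.1 hU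
    rw [hb] at hV
    obtain ⟨n, rfl⟩ := hV
    exact ⟨n, hxV, hVU⟩
  obtain ⟨p, hpc, hpb, hpi⟩ := exists_disjoint_cantor_subset (fun n => hbasis.isOpen (hbmem n))
    (fun n => TopologicalSpace.nonempty_of_mem_countableBasis (hbmem n))
  set code : E → ℕ → Bool := fun x n => decide (x ∈ b n) with hcode
  have hcode_inj : Function.Injective code := by
    intro x y hxy
    by_contra hne
    obtain ⟨n, hxn, hn⟩ := hsmall x {y}ᶜ (isOpen_compl_singleton.mem_nhds hne)
    have := congrFun hxy n
    simp only [hcode, hxn, decide_true] at this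
    exact hn (of_decide_eq_true this.symm) rfl
  set Q : ℕ × (ℕ → Bool) → (ℕ → Bool) → E := fun a s => p a.1 (cantorPair (a.2, s)) with hQ
  have hQc : ∀ a, Continuous (Q a) := fun a => (hpc a.1).comp (by fun_prop)
  have hQi : ∀ a a' s s', Q a s = Q a' s' → a = a' ∧ s = s' := by
    rintro ⟨m, t⟩ ⟨m', t'⟩ s s' h
    obtain ⟨rfl, h2⟩ := hpi _ _ _ _ h
    have h3 := Prod.mk.inj (cantorPair.injective h2)
    exact ⟨Prod.ext rfl h3.1, h3.2⟩
  set D : Set E := {x | ∀ a s, Q a s ≠ x} with hD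
  have hex : ∀ x : E, ∃ m : ℕ → ℕ, ∀ U ∈ 𝓝 x, ∀ᶠ n in atTop, range (p (m n)) ⊆ U := by
    intro x
    obtain ⟨V, hV⟩ := (𝓝 x).exists_antitone_basis
    choose m _ hm using fun n => hsmall x (V n) (hV.1.mem_of_mem trivial)
    refine ⟨m, fun U hU => ?_⟩
    filter_upwards [hV.eventually_subset hU] with n hn
    exact (hpb _).trans ((hm n).trans hn)
  choose m hm using hex
  set asg : D × ℕ → ℕ × (ℕ → Bool) := fun a => (m a.1 a.2, cantorPair (code a.1, spike a.2))
    with hasg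
  have hasg_inj : Function.Injective asg := by
    rintro ⟨x, n⟩ ⟨x', n'⟩ h
    have h2 := cantorPair.injective (congrArg Prod.snd h)
    exact Prod.ext (Subtype.ext (hcode_inj (congrArg Prod.fst h2)))
      (spike_injective (congrArg Prod.snd h2))
  have hins : ∀ x : D, ∃ h : (ℕ → Bool) → E, Continuous h ∧ Function.Injective h ∧
      range h = insert (x : E) (⋃ n, range (Q (asg (x, n)))) := by
    intro x
    refine exists_cantor_insert (fun n => hQc _) (fun i j s t h => ?_) (fun n s => x.2 _ s) ?_
    · obtain ⟨h1, h2⟩ := hQi _ _ _ _ h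
      exact ⟨congrArg Prod.snd (hasg_inj h1), h2⟩
    · intro U hU
      filter_upwards [hm x U hU] with n hn
      rintro _ ⟨s, rfl⟩
      exact hn (mem_range_self _)
  choose G hGc hGi hGr using hins
  let I := D ⊕ {a : ℕ × (ℕ → Bool) // a ∉ range asg}
  let K : I → (ℕ → Bool) → E := Sum.elim G fun a => Q a.1
  have hKc : ∀ i, Continuous (K i) := by
    rintro (x | a)
    exacts [hGc x, hQc a.1]
  have hGmem : ∀ x s, G x s = x ∨ ∃ n s', Q (asg (x, n)) s' = G x s := by
    intro x s
    have : G x s ∈ range (G x) := mem_range_self s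
    rw [hGr] at this
    simpa using this
  have hKi : ∀ i j s t, K i s = K j t → i = j ∧ s = t := by
    have hQD : ∀ (x : D) a s, Q a s ≠ x := fun x => x.2
    have hmix : ∀ (x : D) (a : {a : ℕ × (ℕ → Bool) // a ∉ range asg}) s t,
        G x s ≠ Q a.1 t := by
      intro x a s t h
      rcases hGmem x s with h' | ⟨n, s', h'⟩
      · exact hQD x _ _ (h.symm.trans h')
      · exact a.2 ⟨_, (hQi _ _ _ _ (h'.trans h)).1⟩
    have hGG : ∀ x y s t, G x s = G y t → x = y := by
      intro x y s t h
      rcases hGmem x s with h1 | ⟨n, s', h1⟩ <;> rcases hGmem y t with h2 | ⟨k, t', h2⟩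
      · exact Subtype.ext (h1.symm.trans (h.trans h2))
      · exact absurd (h2.trans (h.symm.trans h1)) (hQD x _ _)
      · exact absurd (h1.trans (h.trans h2)) (hQD y _ _)
      · exact congrArg Prod.fst (hasg_inj (hQi _ _ _ _ (h1.trans (h.trans h2.symm))).1)
    rintro (x | a) (y | c) s t h
    · obtain rfl := hGG x y s t h
      exact ⟨rfl, hGi x h⟩
    · exact absurd h (hmix x c s t)
    · exact absurd h.symm (hmix y a t s)
    · obtain ⟨h1, h2⟩ := hQi _ _ _ _ h
      exact ⟨congrArg Sum.inr (Subtype.ext h1), h2⟩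
  have hKs : ∀ y, ∃ i s, K i s = y := by
    intro y
    by_cases hy : y ∈ D
    · have : y ∈ range (G ⟨y, hy⟩) := by rw [hGr]; exact Or.inl rfl
      obtain ⟨s, hs⟩ := this
      exact ⟨Sum.inl ⟨y, hy⟩, s, hs⟩
    · simp only [hD, mem_ofPred_eq, not_forall, not_not] at hy
      obtain ⟨a, s, has⟩ := hy
      by_cases ha : a ∈ range asg
      · obtain ⟨⟨x, n⟩, rfl⟩ := ha
        have : y ∈ range (G x) := by
          rw [hGr]; exact Or.inr (mem_iUnion.2 ⟨n, s, has⟩)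
        obtain ⟨s', hs'⟩ := this
        exact ⟨Sum.inl x, s', hs'⟩
      · exact ⟨Sum.inr ⟨a, ha⟩, s, has⟩
  have hfree : ∀ s, ((0 : ℕ), cantorPair (s, fun _ => true)) ∉ range asg := by
    rintro s ⟨⟨x, n⟩, h⟩
    have h2 := congrArg Prod.snd (cantorPair.injective (congrArg Prod.snd h))
    have h3 := congrFun h2 (n + 1)
    simp [spike] at h3
  let toI : E → I := fun x => Sum.inr ⟨_, hfree (code x)⟩
  have htoI : Function.Injective toI := by
    intro x y h
    have h1 := congrArg Subtype.val (Sum.inr_injective h)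
    have h2 := cantorPair.injective (congrArg Prod.snd h1)
    exact hcode_inj (congrArg Prod.fst h2)
  have hofI : Function.Injective fun i => K i fun _ => false := fun i j h => (hKi _ _ _ _ h).1
  obtain ⟨e⟩ := Function.Embedding.antisymm ⟨toI, htoI⟩ ⟨_, hofI⟩
  refine ⟨fun x => K (e x), fun x => hKc _, fun x y s t h => ?_, fun y => ?_⟩
  · obtain ⟨h1, h2⟩ := hKi _ _ _ _ h
    exact ⟨e.injective h1, h2⟩
  · obtain ⟨i, s, h⟩ := hKs y
    exact ⟨e.symm i, s, by simpa using h⟩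

end CantorPartition

section EndpointSpace

lemma polishSpace_iInter {Y : Type*} [TopologicalSpace Y] [PolishSpace Y] {U : ℕ → Set Y}
    (hU : ∀ n, IsOpen (U n)) : PolishSpace (⋂ n, U n : Set Y) := by
  have : ∀ n, PolishSpace (U n) := fun n => (hU n).polishSpace
  let f : (⋂ n, U n : Set Y) → ∀ n, U n := fun y n => ⟨y, mem_iInter.1 y.2 n⟩
  have hf : Continuous f := by fun_prop
  have hg : Continuous fun g : ∀ n, U n => (g 0 : Y) := by fun_prop
  have hind : IsInducing f := IsInducing.of_comp hf hg IsInducing.subtypeVal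
  have hinj : Function.Injective f := fun y z h =>
    Subtype.ext (congrArg (fun g : ∀ n, U n => (g 0 : Y)) h)
  refine IsClosedEmbedding.polishSpace (f := f) ⟨⟨hind, hinj⟩, ?_⟩
  have : range f = ⋂ n, {g : ∀ n, U n | (g n : Y) = g 0} := by
    ext g
    simp only [mem_iInter, mem_ofPred_eq]
    constructor
    · rintro ⟨y, rfl⟩ n
      rfl
    · intro h
      refine ⟨⟨g 0, mem_iInter.2 fun n => h n ▸ (g n).2⟩, funext fun n => Subtype.ext (h n).symm⟩
  rw [this]
  exact isClosed_iInter fun n => isClosed_eq (by fun_prop) (by fun_prop)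

lemma continuous_of_isClosed_graph {A B : Type*} [TopologicalSpace A] [TopologicalSpace B]
    [CompactSpace B] {f : A → B} (hf : IsClosed {p : A × B | f p.1 = p.2}) : Continuous f := by
  rw [continuous_iff_isClosed]
  intro C hC
  convert isClosedMap_fst_of_compactSpace _ (hf.inter (hC.preimage continuous_snd)) using 1
  ext a
  simp

variable {X : Type*} [MetricSpace X] {L : Set X} {v : X} {μ : X → ℝ}

lemma IsHeight.isClosed_lowered (hμ : IsHeight L v μ) (hS : IsSmoothFan L v) (ε : ℝ) :
    IsClosed {x : X | ∃ z ∈ L, x ∈ segTo L v z ∧ μ x + ε ≤ μ z} := by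
  have hL := hS.1.1.1
  have hv := hS.1.2.1
  have hR := hS.isCompact_segTo_rel
  have h1 : ContinuousOn (fun p : X × X => μ p.1 - μ p.2)
      {p : X × X | p.1 ∈ L ∧ p.2 ∈ segTo L v p.1} :=
    (hμ.continuousOn.comp continuousOn_fst fun p hp => hp.1).sub
      (hμ.continuousOn.comp continuousOn_snd fun p hp => (hL.segTo_spec hv hp.1).1 hp.2)
  have h2 := (hR.of_isClosed_subset (h1.preimage_isClosed_of_isClosed hR.isClosed
    (isClosed_Ici (a := ε))) inter_subset_left).image continuous_snd
  convert h2.isClosed using 1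
  ext x
  constructor
  · rintro ⟨z, hz, hxz, h⟩
    exact ⟨(z, x), ⟨⟨hz, hxz⟩, mem_preimage.2 (mem_Ici.2 (le_sub_iff_add_le'.2 h))⟩, rfl⟩
  · rintro ⟨⟨z, y⟩, ⟨⟨hz, hyz⟩, h⟩, rfl⟩
    exact ⟨z, hz, hyz, le_sub_iff_add_le'.1 (mem_Ici.1 (mem_preimage.1 h))⟩

lemma IsHeight.isEndpoint_iff (hμ : IsHeight L v μ) (hS : IsSmoothFan L v) {x : X} (hx : x ∈ L) :
    IsEndpoint L x ↔ ∀ n : ℕ, ¬ ∃ z ∈ L, x ∈ segTo L v z ∧ μ x + 1 / ((n : ℝ) + 1) ≤ μ z := by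
  have hL := hS.1.1.1
  have hv := hS.1.2.1
  constructor
  · rintro he n ⟨z, hz, hxz, h⟩
    rw [he.eq_of_mem_segTo hL hv (hS.1.ne_of_isEndpoint he) hz hxz] at h
    have : (0:ℝ) < 1 / ((n : ℝ) + 1) := by positivity
    linarith
  · intro h
    have hmax : ∀ z ∈ L, x ∈ segTo L v z → z = x := by
      intro z hz hxz
      by_contra hne
      obtain ⟨n, hn⟩ := exists_nat_one_div_lt
        (sub_pos.2 (hμ.lt_of_mem z hz x hxz (Ne.symm hne)))
      exact h n ⟨z, hz, hxz, by linarith⟩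
    refine hL.isEndpoint_of_maximal hv hx ?_ hmax
    rintro rfl
    obtain ⟨T, hT, hTv⟩ := hS.1.2.2
    obtain ⟨A, hAT, hA, hvA, hne⟩ := hTv.exists_arc
    obtain ⟨γ, -, hi, rfl⟩ := hA.exists_param
    have : ∀ t ∈ Icc (0:ℝ) 1, γ t = v := fun t ht =>
      have hm := hT (hAT (mem_image_of_mem γ ht))
      hmax _ hm (hL.left_mem_segTo hv hm)
    exact zero_ne_one (hi (by simp) (by simp) ((this 0 (by simp)).trans (this 1 (by simp)).symm))

lemma IsSmoothFan.polishSpace_endpoints (hS : IsSmoothFan L v) :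
    PolishSpace {x : L | IsEndpoint L x} := by
  obtain ⟨μ, hμ⟩ := hS.exists_height
  have : CompactSpace L := isCompact_iff_compactSpace.1 hS.1.1.1.1.1
  have hU : ∀ n : ℕ, IsOpen {x : L | ∃ z ∈ L, (x : X) ∈ segTo L v z ∧
      μ x + 1 / ((n : ℝ) + 1) ≤ μ z}ᶜ := fun n =>
    ((hμ.isClosed_lowered hS _).preimage continuous_subtype_val).isOpen_compl
  have heq : {x : L | IsEndpoint L x} = ⋂ n : ℕ, {x : L | ∃ z ∈ L, (x : X) ∈ segTo L v z ∧
      μ x + 1 / ((n : ℝ) + 1) ≤ μ z}ᶜ := by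
    ext x
    simpa using hμ.isEndpoint_iff hS x.2
  rw [heq]
  exact polishSpace_iInter hU

lemma IsLelekFan.perfectSpace_endpoints (h : IsLelekFan L v) :
    PerfectSpace {x : L | IsEndpoint L x} := by
  have hS := h.1
  have hL := hS.1.1.1
  have hv := hS.1.2.1
  rw [perfectSpace_iff_forall_not_isolated]
  rintro ⟨⟨e, heL⟩, he : IsEndpoint L e⟩
  have hve := hS.1.ne_of_isEndpoint he
  rw [← mem_closure_iff_nhdsWithin_neBot, mem_closure_iff_nhds]
  intro W hW
  obtain ⟨W', hW', hW'W⟩ := mem_nhds_subtype _ _ _ |>.1 hW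
  obtain ⟨V, hV, hVW⟩ := mem_nhds_subtype _ _ _ |>.1 hW'
  obtain ⟨O, hOV, hO, heO⟩ := mem_nhds_iff.1 hV
  obtain ⟨γ, hc, hi, him, h0, h1, -⟩ := hL.exists_segTo_param hv heL hve
  have hev : ∀ᶠ t in 𝓝[<] (1:ℝ), γ t ∈ O ∧ t ∈ Ioo (0:ℝ) 1 :=
    ((hc.tendsto 1).mono_left nhdsWithin_le_nhds |>.eventually (hO.mem_nhds (h1.symm ▸ heO))).and
      (Ioo_mem_nhdsLT zero_lt_one)
  obtain ⟨t, htO, ht⟩ := hev.exists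
  have htL : γ t ∈ L := (hL.segTo_spec hv heL).1
    (him ▸ mem_image_of_mem γ (Ioo_subset_Icc_self ht))
  have hne : γ t ≠ e := fun hte => ht.2.ne
    (hi (Ioo_subset_Icc_self ht) (by simp) (hte.trans h1.symm))
  obtain ⟨e', ⟨he'O, he'e⟩, he'⟩ := mem_closure_iff.1 (h.2 htL) (O ∩ {e}ᶜ)
    (hO.inter isOpen_compl_singleton) ⟨htO, hne⟩
  refine ⟨⟨⟨e', he'.1⟩, he'⟩, hW'W (hVW (hOV he'O)), fun heq => he'e ?_⟩
  exact congrArg (fun x : {x : L | IsEndpoint L x} => ((x : L) : X)) heq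

lemma IsLelekFan.exists_isEndpoint (h : IsLelekFan L v) : ∃ e, IsEndpoint L e :=
  closure_nonempty_iff.1 ⟨v, h.2 h.1.1.2.1⟩

end EndpointSpace

section CantorFans
variable {X : Type*} [MetricSpace X] {L : Set X} {v : X} {c : (ℕ → Bool) → X}

/-- The cone over a Cantor set of endpoints of a smooth fan embeds in the fan. -/
lemma IsSmoothFan.exists_cone (hS : IsSmoothFan L v) (hc : Continuous c)
    (hi : Function.Injective c) (he : ∀ s, IsEndpoint L (c s)) :
    ∃ f : CantorFanSpace → X, Continuous f ∧ Function.Injective f ∧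
      range f = ⋃ s, segTo L v (c s) := by
  obtain ⟨μ, hμ⟩ := hS.exists_height
  have hF := hS.1
  have hL := hF.1.1
  have hv := hF.2.1
  have hve : ∀ s, v ≠ c s := fun s => hF.ne_of_isEndpoint (he s)
  have hpos : ∀ s, 0 < μ (c s) := fun s => hμ.pos hL hv (he s).1 (hve s)
  have : CompactSpace L := isCompact_iff_compactSpace.1 hL.1.1
  have hex : ∀ p : (ℕ → Bool) × Icc (0:ℝ) 1, ∃ y : L, (y : X) ∈ segTo L v (c p.1) ∧
      μ y = p.2 * μ (c p.1) := by
    intro p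
    obtain ⟨y, hy, hyμ⟩ := hμ.exists_mem_eq hL hv (he p.1).1 (c := p.2 * μ (c p.1))
      ⟨mul_nonneg p.2.2.1 (hpos _).le, mul_le_of_le_one_left (hpos _).le p.2.2.2⟩
    exact ⟨⟨y, (hL.segTo_spec hv (he p.1).1).1 hy⟩, hy, hyμ⟩
  choose Φ hΦ hΦμ using hex
  have huniq : ∀ p (y : L), (y : X) ∈ segTo L v (c p.1) → μ y = p.2 * μ (c p.1) → Φ p = y :=
    fun p y hy hyμ => Subtype.ext
      (hμ.injOn_segTo hL hv (he p.1).1 (hΦ p) hy ((hΦμ p).trans hyμ.symm))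
  have hμL : Continuous fun y : L => μ y :=
    continuousOn_iff_continuous_domRestrict.1 hμ.continuousOn
  have hμc : Continuous fun s => μ (c s) := hμ.continuousOn.comp_continuous hc fun s => (he s).1
  have hΦc : Continuous Φ := by
    refine continuous_of_isClosed_graph ?_
    have h1 : IsClosed {q : ((ℕ → Bool) × Icc (0:ℝ) 1) × L |
        (q.2 : X) ∈ segTo L v (c q.1.1)} := by
      convert hS.isCompact_segTo_rel.isClosed.preimage
        (f := fun q : ((ℕ → Bool) × Icc (0:ℝ) 1) × L =>
        (c q.1.1, (q.2 : X))) (by fun_prop) using 1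
      ext q
      simp [(he q.1.1).1]
    have h2 : IsClosed {q : ((ℕ → Bool) × Icc (0:ℝ) 1) × L | μ q.2 = q.1.2 * μ (c q.1.1)} :=
      isClosed_eq (hμL.comp continuous_snd)
        ((by fun_prop : Continuous fun q : ((ℕ → Bool) × Icc (0:ℝ) 1) × L => (q.1.2 : ℝ)).mul
          (hμc.comp (continuous_fst.comp continuous_fst)))
    convert h1.inter h2 using 1
    ext q
    constructor
    · rintro (h : Φ q.1 = q.2)
      exact ⟨show (q.2 : X) ∈ _ from h ▸ hΦ q.1, show μ q.2 = _ from h ▸ hΦμ q.1⟩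
    · exact fun h => huniq q.1 q.2 h.1 h.2
  have hΦv : ∀ p, (Φ p : X) = v ↔ (p.2 : ℝ) = 0 := by
    intro p
    constructor
    · intro h
      have := hΦμ p
      rw [h, hμ.map_top] at this
      exact (mul_eq_zero.1 this.symm).resolve_right (hpos _).ne'
    · intro h
      exact congrArg Subtype.val (huniq p ⟨v, hv⟩ (hL.left_mem_segTo hv (he p.1).1)
        (by rw [h, zero_mul, hμ.map_top]))
  refine ⟨Quotient.lift (fun p => (Φ p : X)) ?_,
    (continuous_subtype_val.comp hΦc).quotient_lift _, ?_, ?_⟩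
  · rintro p q (rfl | h)
    · rfl
    · exact ((hΦv p).2 h.1).trans ((hΦv q).2 h.2).symm
  · intro a b
    induction a, b using Quotient.inductionOn₂ with | _ p q => ?_
    intro (h : (Φ p : X) = Φ q)
    refine Quotient.sound ?_
    by_cases hpq : p.1 = q.1
    · refine Or.inl (Prod.ext hpq (Subtype.ext ?_))
      have h1 := hΦμ p
      rw [h, hΦμ q, ← hpq] at h1
      exact (mul_right_cancel₀ (hpos _).ne' h1).symm
    · have hm : (Φ p : X) ∈ segTo L v (c p.1) ∩ segTo L v (c q.1) := ⟨hΦ p, h ▸ hΦ q⟩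
      rw [hμ.segTo_inter_segTo hF (he _) (he _) (hi.ne hpq), mem_singleton_iff] at hm
      exact Or.inr ⟨(hΦv p).1 hm, (hΦv q).1 (h.symm.trans hm)⟩
  · ext y
    constructor
    · rintro ⟨a, rfl⟩
      induction a using Quotient.inductionOn with | _ p => ?_
      exact mem_iUnion.2 ⟨p.1, hΦ p⟩
    · intro hy
      obtain ⟨s, hs⟩ := mem_iUnion.1 hy
      have hyL := (hL.segTo_spec hv (he s).1).1 hs
      refine ⟨⟦(s, ⟨μ y / μ (c s), div_nonneg (hμ.nonneg hL hv hyL) (hpos s).le,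
        (div_le_one (hpos s)).2 (hμ.le_of_mem (he s).1 hs)⟩)⟧, ?_⟩
      exact congrArg Subtype.val (huniq _ ⟨y, hyL⟩ hs (div_mul_cancel₀ _ (hpos s).ne').symm)

lemma IsSmoothFan.isCantorFan_iUnion (hS : IsSmoothFan L v) (hc : Continuous c)
    (hi : Function.Injective c) (he : ∀ s, IsEndpoint L (c s)) :
    IsCantorFan (⋃ s, segTo L v (c s)) v := by
  obtain ⟨μ, hμ⟩ := hS.exists_height
  have hF := hS.1
  have hL := hF.1.1
  have hv := hF.2.1
  have hve : ∀ s, v ≠ c s := fun s => hF.ne_of_isEndpoint (he s)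
  obtain ⟨f, hfc, hfi, hfr⟩ := hS.exists_cone hc hi he
  have hKL : ⋃ s, segTo L v (c s) ⊆ L := iUnion_subset fun s => (hL.segTo_spec hv (he s).1).1
  have hK : IsSubcontinuum (⋃ s, segTo L v (c s)) := by
    refine ⟨hfr ▸ isCompact_range hfc, ⟨v, mem_iUnion.2 ⟨fun _ => false,
      hL.left_mem_segTo hv (he _).1⟩⟩, isPreconnected_iUnion ⟨v, mem_iInter.2 fun s =>
        hL.left_mem_segTo hv (he s).1⟩ fun s => ?_⟩
    exact (hL.segTo_spec hv (he s).1).2.isSubcontinuum.2.isPreconnected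
  refine ⟨⟨⟨⟨hK, fun x hx y hy hxy => ?_, fun A hA => hL.2.2 A (hA.trans hKL)⟩,
    fun x y hx hy => hF.1.2 x y ?_ ?_⟩, mem_iUnion.2 ⟨fun _ => false,
      hL.left_mem_segTo hv (he _).1⟩, ?_⟩, ⟨?_⟩⟩
  · obtain ⟨A, hAL, hA⟩ := hL.2.1 x (hKL hx) y (hKL hy) hxy
    have harc : IsArcFromTo A x y := Or.inr ⟨hxy, hA⟩
    refine ⟨A, ?_, hA⟩
    exact (harc.subset_of_isPreconnected
      (hL.isPreconnected_inter harc.isSubcontinuum hK hAL hKL) inter_subset_left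
      ⟨harc.left_mem, hx⟩ ⟨harc.right_mem, hy⟩).trans inter_subset_right
  · exact ⟨hKL hx.1, hx.2.imp fun T hT => ⟨hT.1.trans hKL, hT.2⟩⟩
  · exact ⟨hKL hy.1, hy.2.imp fun T hT => ⟨hT.1.trans hKL, hT.2⟩⟩
  · choose γ hγc hγi him h0 _ _ using fun i : Fin 3 =>
      hL.exists_segTo_param hv (he (spike i)).1 (hve (spike i))
    obtain ⟨T, hT, hTv⟩ := exists_triod hγc hγi h0 fun i j hij s hs t ht hst => by
      have hm : γ i s ∈ segTo L v (c (spike i)) ∩ segTo L v (c (spike j)) :=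
        ⟨him i ▸ mem_image_of_mem _ hs, hst ▸ him j ▸ mem_image_of_mem _ ht⟩
      rw [hμ.segTo_inter_segTo hF (he _) (he _) (hi.ne (spike_injective.ne
        (Fin.val_injective.ne hij))), mem_singleton_iff] at hm
      exact hγi i hs (by simp) (hm.trans (h0 i).symm)
    exact ⟨T, hT.trans (iUnion_subset fun i => him i ▸ subset_iUnion_of_subset _ Subset.rfl), hTv⟩
  · exact ((Homeomorph.setCongr hfr.symm).trans
      (hfc.isClosedEmbedding hfi).isEmbedding.toHomeomorph.symm)

end CantorFans

/-- a Lelek fan is a union of Cantor fans, one for each leg,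
meeting pairwise exactly at the top. -/
theorem stmt6 {X : Type*} [MetricSpace X] (L : Set X) (v : X) (hL : IsLelekFan L v) :
    ∃ Cfam : Set X → Set X,
      (∀ A ∈ Legs L v, Cfam A ⊆ L ∧ IsCantorFan (Cfam A) v) ∧
      (∀ A₁ ∈ Legs L v, ∀ A₂ ∈ Legs L v, A₁ ≠ A₂ → Cfam A₁ ∩ Cfam A₂ = {v}) ∧
      (⋃ A ∈ Legs L v, Cfam A) = L := by
  classical
  have hS := hL.1
  have hF := hS.1
  have hD := hF.1.1
  have hv := hF.2.1
  obtain ⟨μ, hμ⟩ := hS.exists_height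
  obtain ⟨e₀, he₀⟩ := hL.exists_isEndpoint
  have := hS.polishSpace_endpoints
  have := hL.perfectSpace_endpoints
  have : Nonempty {x : L | IsEndpoint L x} := ⟨⟨⟨e₀, he₀.1⟩, he₀⟩⟩
  obtain ⟨g, hgc, hgi, hgs⟩ := exists_cantor_partition (E := {x : L | IsEndpoint L x})
  let c : {x : L | IsEndpoint L x} → (ℕ → Bool) → X := fun e s => ((g e s : L) : X)
  have hce : ∀ e s, IsEndpoint L (c e s) := fun e s => (g e s).2
  have hci : ∀ e e' s s', c e s = c e' s' → e = e' ∧ s = s' := fun e e' s s' h =>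
    hgi e e' s s' (Subtype.ext (Subtype.ext h))
  have hleg : ∀ A : Set X, ∃ e : {x : L | IsEndpoint L x},
      A ∈ Legs L v → segTo L v (e : L) = A := by
    intro A
    by_cases hA : A ∈ Legs L v
    · obtain ⟨e, he, hAL, harc⟩ := hA
      exact ⟨⟨⟨e, he.1⟩, he⟩, fun _ => hD.eq_segTo hAL harc⟩
    · exact ⟨⟨⟨e₀, he₀.1⟩, he₀⟩, fun h => absurd h hA⟩
  choose e he using hleg
  have hsub : ∀ A, ⋃ s, segTo L v (c (e A) s) ⊆ L := fun A =>
    iUnion_subset fun s => (hD.segTo_spec hv (hce _ s).1).1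
  have hmem : ∀ x : {x : L | IsEndpoint L x}, ∃ A ∈ Legs L v, e A = x := by
    rintro ⟨⟨x, hxL⟩, hx⟩
    have hA : segTo L v x ∈ Legs L v := ⟨x, hx, hD.segTo_spec hv hxL⟩
    refine ⟨_, hA, Subtype.ext (Subtype.ext ?_)⟩
    have h := he _ hA
    have hr := hD.right_mem_segTo hv (e (segTo L v x)).1.2
    rw [h] at hr
    exact hD.segTo_antisymm hv hxL hr
      (h.symm ▸ hD.right_mem_segTo hv hxL)
  refine ⟨fun A => ⋃ s, segTo L v (c (e A) s), fun A _ => ⟨hsub A, ?_⟩, ?_, ?_⟩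
  · exact hS.isCantorFan_iUnion
      (continuous_subtype_val.comp (continuous_subtype_val.comp (hgc _)))
      (fun s s' h => (hci _ _ _ _ h).2) (hce _)
  · intro A hA B hB hAB
    refine Subset.antisymm ?_ (singleton_subset_iff.2 ⟨mem_iUnion.2 ⟨fun _ => false,
      hD.left_mem_segTo hv (hce _ _).1⟩, mem_iUnion.2 ⟨fun _ => false,
      hD.left_mem_segTo hv (hce _ _).1⟩⟩)
    rintro x ⟨hxA, hxB⟩
    obtain ⟨s, hs⟩ := mem_iUnion.1 hxA
    obtain ⟨t, ht⟩ := mem_iUnion.1 hxB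
    rw [← hμ.segTo_inter_segTo hF (hce _ s) (hce _ t) fun h => hAB ?_]
    · exact ⟨hs, ht⟩
    · rw [← he A hA, ← he B hB, (hci _ _ _ _ h).1]
  · refine Subset.antisymm (iUnion₂_subset fun A _ => hsub A) fun x hx => ?_
    obtain ⟨y, hy, hxy⟩ : ∃ y, IsEndpoint L y ∧ x ∈ segTo L v y := by
      by_cases hvx : v = x
      · exact ⟨e₀, he₀, hvx ▸ hD.left_mem_segTo hv he₀.1⟩
      · exact hμ.exists_isEndpoint hS hx hvx
    obtain ⟨z, s, hzs⟩ := hgs ⟨⟨y, hy.1⟩, hy⟩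
    obtain ⟨A, hA, rfl⟩ := hmem z
    refine mem_iUnion₂.2 ⟨A, hA, mem_iUnion.2 ⟨s, ?_⟩⟩
    have : c (e A) s = y := congrArg (fun x : {x : L | IsEndpoint L x} => ((x : L) : X)) hzs
    rwa [this]
end

section
/- Let C be the Cantor set, L' a Lelek fan with top w, and define the quotient (C × L')/∼ by (c₁,x₁) ∼ (c₂,x₂) iff (c₁,x₁) = (c₂,x₂) or x₁ = x₂ = w. Then (C × L')/∼ is a Lelek fan. -/
open Set Topology Filter

/-- The setoid on `C × L'` collapsing the fiber over the top `w` of `L'` to one point. -/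
def lelekConeSetoid (X : Type*) (w : X) : Setoid ((ℕ → Bool) × X) where
  r a b := a = b ∨ (a.2 = w ∧ b.2 = w)
  iseqv := by
    refine ⟨fun a => Or.inl rfl, ?_, ?_⟩
    · rintro a b (rfl | h)
      · exact Or.inl rfl
      · exact Or.inr ⟨h.2, h.1⟩
    · rintro a b c (rfl | h) (rfl | h')
      · exact Or.inl rfl
      · exact Or.inr h'
      · exact Or.inr h
      · exact Or.inr ⟨h.1, h'.2⟩

section Pegs

variable {X : Type*} [TopologicalSpace X]

/-- `x` is the image of the origin under some topological embedding of the model set `S`. -/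
def IsPeg {E : Type*} [TopologicalSpace E] [Zero E] (S : Set E) (x : X) : Prop :=
  ∃ f : E → X, ContinuousOn f S ∧ InjOn f S ∧ f 0 = x

theorem IsPeg.map {E Y : Type*} [TopologicalSpace E] [Zero E] [TopologicalSpace Y] {S : Set E}
    {x : X} (h : IsPeg S x) {i : X → Y} (hi : Continuous i) (hinj : Function.Injective i) :
    IsPeg S (i x) := by
  obtain ⟨f, hf, hfi, rfl⟩ := h
  exact ⟨i ∘ f, hi.comp_continuousOn hf, hinj.comp_injOn hfi, rfl⟩

theorem isPeg_of_homeomorph {E : Type*} [TopologicalSpace E] [Zero E] {S : Set E} (h0 : 0 ∈ S)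
    {A : Set X} (φ : S ≃ₜ A) {x : X} (hx : (φ ⟨0, h0⟩ : X) = x) : IsPeg S x := by
  classical
  have key : ∀ s : S, Function.extend (Subtype.val : S → E) (fun s => (φ s : X)) (fun _ => x) s
      = φ s := fun s => Subtype.val_injective.extend_apply _ _ s
  refine ⟨Function.extend (Subtype.val : S → E) (fun s => (φ s : X)) (fun _ => x), ?_, ?_, ?_⟩
  · rw [continuousOn_iff_continuous_domRestrict]
    exact (continuous_subtype_val.comp φ.continuous).congr fun s => (key s).symm
  · intro a ha b hb hab
    have hab' : (φ ⟨a, ha⟩ : X) = φ ⟨b, hb⟩ := by rw [← key, ← key]; exact hab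
    simpa using φ.injective (Subtype.ext hab')
  · exact (key ⟨0, h0⟩).trans hx

theorem exists_homeomorph_image [T2Space X] {E : Type*} [TopologicalSpace E] {S : Set E}
    (hS : IsCompact S) {f : E → X} (hf : ContinuousOn f S) (hfi : InjOn f S) :
    ∃ φ : S ≃ₜ f '' S, ∀ s : S, (φ s : X) = f s := by
  have : CompactSpace S := isCompact_iff_compactSpace.mp hS
  refine ⟨Continuous.homeoOfEquivCompactToT2 (f := Equiv.Set.imageOfInjOn f S hfi) ?_,
    fun s => rfl⟩
  exact (continuousOn_iff_continuous_domRestrict.mp hf).subtype_mk _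

theorem triodModel_isCompact : IsCompact triodModel :=
  (isCompact_Icc.prod isCompact_singleton).union (isCompact_singleton.prod isCompact_Icc)

theorem triodModel_starConvex : StarConvex ℝ 0 triodModel :=
  ((convex_Icc (-1 : ℝ) 1).prod (convex_singleton (0 : ℝ))).starConvex (by simp) |>.union
    (((convex_singleton (0 : ℝ)).prod (convex_Icc (0 : ℝ) 1)).starConvex (by simp))

theorem isRamificationPoint_univ_iff [T2Space X] {x : X} :
    IsRamificationPoint univ x ↔ IsPeg triodModel x := by
  constructor
  · rintro ⟨-, T, -, φ, hφ⟩
    exact isPeg_of_homeomorph triod_top_mem φ hφ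
  · rintro ⟨f, hf, hfi, h0⟩
    obtain ⟨φ, hφ⟩ := exists_homeomorph_image triodModel_isCompact hf hfi
    exact ⟨mem_univ _, _, subset_univ _, φ, (hφ _).trans h0⟩

theorem IsPeg.interval_of_triodModel {x : X} (h : IsPeg triodModel x) :
    IsPeg (Icc (-1 : ℝ) 1) x := by
  obtain ⟨f, hf, hfi, h0⟩ := h
  have hm : MapsTo (fun t : ℝ => (t, (0 : ℝ))) (Icc (-1) 1) triodModel :=
    fun t ht => Or.inl ⟨ht, rfl⟩
  refine ⟨fun t => f (t, 0), hf.comp (by fun_prop) hm, ?_, h0⟩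
  intro a ha b hb hab
  simpa using hfi (hm ha) (hm hb) hab

theorem IsEndpointOfArc.endpoint_cases {A : Set X} (φ : Icc (0 : ℝ) 1 ≃ₜ A) {x : X}
    (h : IsEndpointOfArc A x) : (φ 0 : X) = x ∨ (φ 1 : X) = x := by
  obtain ⟨ψ, rfl⟩ := h
  let g : Icc (0 : ℝ) 1 ≃ₜ Icc (0 : ℝ) 1 := ψ.trans φ.symm
  have hg : ∀ t, φ (g t) = ψ t := fun t => φ.apply_symm_apply _
  change (φ 0 : X) = (ψ 0 : X) ∨ (φ 1 : X) = (ψ 0 : X)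
  rcases g.continuous.strictMono_of_inj_boundedOrder' g.injective with hm | hm
  · left
    obtain ⟨t, ht⟩ := g.surjective 0
    have : g 0 = 0 := le_antisymm ((hm.monotone unitInterval.nonneg').trans_eq ht) (g 0).2.1
    rw [← hg, this]
  · right
    obtain ⟨t, ht⟩ := g.surjective 1
    have : g 0 = 1 := le_antisymm (g 0).2.2 (ht.ge.trans (hm.antitone unitInterval.nonneg'))
    rw [← hg, this]

theorem IsEndpointOfArc.of_homeomorph_zero {A : Set X} (φ : Icc (0 : ℝ) 1 ≃ₜ A) :
    IsEndpointOfArc A (φ 0 : X) := ⟨φ, rfl⟩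

theorem IsEndpointOfArc.of_homeomorph_one {A : Set X} (φ : Icc (0 : ℝ) 1 ≃ₜ A) :
    IsEndpointOfArc A (φ 1 : X) :=
  ⟨unitInterval.symmHomeomorph.trans φ, by
    change (φ (unitInterval.symm 0) : X) = _
    rw [unitInterval.symm_zero]⟩

theorem isEndpoint_univ_iff [T2Space X] {x : X} :
    IsEndpoint univ x ↔ ¬ IsPeg (Icc (-1 : ℝ) 1) x := by
  constructor
  · rintro ⟨-, h⟩ ⟨f, hf, hfi, rfl⟩
    obtain ⟨φ, hφ⟩ := exists_homeomorph_image isCompact_Icc hf hfi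
    let a : Icc (0 : ℝ) 1 ≃ₜ Icc (-1 : ℝ) 1 := (iccHomeoI (-1 : ℝ) 1 (by norm_num)).symm
    have ha : ∀ t, (a t : ℝ) = (1 - (-1)) * t + -1 := iccHomeoI_symm_apply_coe _ _ _
    have hA := h _ (subset_univ _) ⟨(a.trans φ).symm⟩ (mem_image_of_mem f (by simp))
    have h0 : (0 : ℝ) ∈ Icc (-1 : ℝ) 1 := by simp
    rcases hA.endpoint_cases (a.trans φ) with h' | h'
    · have := hfi (a 0).2 h0 ((hφ _).symm.trans h')
      rw [ha] at this
      norm_num at this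
    · have := hfi (a 1).2 h0 ((hφ _).symm.trans h')
      rw [ha] at this
      norm_num at this
  · refine fun h => ⟨mem_univ _, fun A _ ⟨φ⟩ hxA => ?_⟩
    set t := φ ⟨x, hxA⟩ with ht
    have hφt : (φ.symm t : X) = x := by simp [ht]
    rcases eq_or_lt_of_le t.2.1 with h0 | h0
    · have : t = 0 := Subtype.ext h0.symm
      rw [← hφt, this]
      exact .of_homeomorph_zero φ.symm
    rcases eq_or_lt_of_le t.2.2 with h1 | h1
    · have : t = 1 := Subtype.ext h1
      rw [← hφt, this]
      exact .of_homeomorph_one φ.symm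
    refine absurd ?_ h
    set ε : ℝ := min t (1 - t) with hε
    have hε0 : 0 < ε := lt_min h0 (sub_pos.2 h1)
    have hε1 : ε ≤ t := min_le_left _ _
    have hε2 : ε ≤ 1 - t := min_le_right _ _
    have hmem : ∀ s ∈ Icc (-1 : ℝ) 1, (t : ℝ) + s * ε ∈ Icc (0 : ℝ) 1 := fun s hs =>
      ⟨by nlinarith [hs.1], by nlinarith [hs.2]⟩
    refine ⟨fun s => φ.symm (projIcc 0 1 zero_le_one (t + s * ε)), ?_, ?_, ?_⟩
    · exact Continuous.continuousOn (continuous_subtype_val.comp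
        (φ.symm.continuous.comp (continuous_projIcc.comp (by fun_prop))))
    · intro a ha b hb hab
      have hab' := φ.symm.injective (Subtype.ext hab)
      rw [projIcc_of_mem _ (hmem a ha), projIcc_of_mem _ (hmem b hb)] at hab'
      simpa [hε0.ne'] using hab'
    · simp [hφt]

theorem isArc_with_endpoints_iff [T2Space X] {A : Set X} {x y : X} (hxy : x ≠ y) :
    (IsArc A ∧ IsEndpointOfArc A x ∧ IsEndpointOfArc A y) ↔
      ∃ γ : Path x y, Function.Injective γ ∧ range γ = A := by
  constructor
  · rintro ⟨-, ⟨φ, hφ⟩, hy⟩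
    have hφ0 : (φ 0 : X) = x := hφ
    have hφ1 : (φ 1 : X) = y := (hy.endpoint_cases φ).resolve_left fun h => hxy (hφ0.symm.trans h)
    refine ⟨⟨⟨fun t => φ t, continuous_subtype_val.comp φ.continuous⟩, hφ0, hφ1⟩,
      Subtype.val_injective.comp φ.injective, ?_⟩
    change range (Subtype.val ∘ φ) = A
    rw [range_comp, φ.range_coe, image_univ, Subtype.range_coe]
  · rintro ⟨γ, hγ, rfl⟩
    let φ : Icc (0 : ℝ) 1 ≃ₜ range γ :=
      (γ.continuous.isClosedEmbedding hγ).isEmbedding.toHomeomorph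
    refine ⟨⟨φ.symm⟩, ?_, ?_⟩
    · simpa [φ] using IsEndpointOfArc.of_homeomorph_zero φ
    · simpa [φ] using IsEndpointOfArc.of_homeomorph_one φ

theorem Path.trans_injective {x y z : X} {γ : Path x y} {δ : Path y z}
    (hγ : Function.Injective γ) (hδ : Function.Injective δ)
    (h : ∀ s t, γ s = δ t → t = 0) : Function.Injective (γ.trans δ) := by
  have cross : ∀ s t : unitInterval, (s : ℝ) ≤ 1 / 2 → ¬ (t : ℝ) ≤ 1 / 2 →
      γ.trans δ s ≠ γ.trans δ t := by
    intro s t hs ht hst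
    rw [Path.trans_apply, Path.trans_apply, dif_pos hs, dif_neg ht] at hst
    have := congrArg Subtype.val (h _ _ hst)
    simp only [Icc.coe_zero] at this
    linarith
  intro s t hst
  by_cases hs : (s : ℝ) ≤ 1 / 2 <;> by_cases ht : (t : ℝ) ≤ 1 / 2
  · rw [Path.trans_apply, Path.trans_apply, dif_pos hs, dif_pos ht] at hst
    simpa [Subtype.ext_iff] using hγ hst
  · exact absurd hst (cross s t hs ht)
  · exact absurd hst.symm (cross t s ht hs)
  · rw [Path.trans_apply, Path.trans_apply, dif_neg hs, dif_neg ht] at hst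
    simpa [Subtype.ext_iff] using hδ hst

theorem IsPreconnected.iInter_of_directed [T2Space X] [CompactSpace X] {ι : Type*} [Nonempty ι]
    {V : ι → Set X} (hd : Directed (· ⊇ ·) V) (hc : ∀ i, IsClosed (V i))
    (hp : ∀ i, IsPreconnected (V i)) : IsPreconnected (⋂ i, V i) := by
  rw [isPreconnected_iff_subset_of_fully_disjoint_closed (isClosed_iInter hc)]
  intro u v hu hv huv hdisj
  obtain ⟨U, U', hU, hU', huU, hvU', hUU'⟩ := normal_separation hu hv hdisj
  obtain ⟨i, hi⟩ := exists_subset_nhds_of_compactSpace hd hc (U := U ∪ U') fun x hx =>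
    (hU.union hU').mem_nhds ((huv hx).imp (@huU x) (@hvU' x))
  have hsub : ⋂ i, V i ⊆ V i := iInter_subset V i
  have hdis : V i ∩ (U ∩ U') = ∅ := by rw [hUU'.inter_eq, inter_empty]
  rcases isPreconnected_iff_subset_of_disjoint.mp (hp i) U U' hU hU' hi hdis with h | h
  · exact Or.inl fun x hx => (huv hx).resolve_right fun hxv =>
      disjoint_left.mp hUU' (h (hsub hx)) (hvU' hxv)
  · exact Or.inr fun x hx => (huv hx).resolve_left fun hxu =>
      disjoint_left.mp hUU' (huU hxu) (h (hsub hx))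

theorem IsDendroid.isPreconnected_inter_s7 [T2Space X] (h : IsDendroid (univ : Set X)) {P R : Set X}
    (hPc : IsCompact P) (hP : IsPreconnected P) (hRc : IsCompact R) (hR : IsPreconnected R) :
    IsPreconnected (P ∩ R) := by
  rcases (P ∩ R).eq_empty_or_nonempty with he | ⟨x, hxP, hxR⟩
  · rw [he]; exact isPreconnected_empty
  · exact (h.2.2 (P ∪ R) (subset_univ _)
      ⟨hPc.union hRc, ⟨x, Or.inl hxP⟩, hP.union x hxP hxR hR⟩ P R
      ⟨hPc, ⟨x, hxP⟩, hP⟩ ⟨hRc, ⟨x, hxR⟩, hR⟩ rfl).isPreconnected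

theorem IsArcFromTo.nonempty {A : Set X} {x y : X} (h : IsArcFromTo A x y) : A.Nonempty := by
  rcases h with ⟨-, rfl⟩ | ⟨-, -, ⟨φ, -⟩, -⟩
  · exact singleton_nonempty _
  · exact ⟨_, (φ 0).2⟩

end Pegs

/-- `q` glues the copies `{c} × X` of `X`, one for each `c : C`, together at the point `w`. -/
structure IsBookMap {C X Z : Type*} [TopologicalSpace C] [TopologicalSpace X] [TopologicalSpace Z]
    (q : C × X → Z) (w : X) : Prop where
  continuous : Continuous q
  surjective : Function.Surjective q
  eq_iff : ∀ a b, q a = q b ↔ a = b ∨ (a.2 = w ∧ b.2 = w)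

namespace IsBookMap

section Basic

variable {C X Z : Type*} [TopologicalSpace C] [TopologicalSpace X] [TopologicalSpace Z]
  {q : C × X → Z} {w : X}

/-- A page containing the point `z`. -/
noncomputable def page (h : IsBookMap q w) (z : Z) : C := (Function.surjInv h.surjective z).1

/-- The projection of the book onto a single page. -/
noncomputable def proj (h : IsBookMap q w) (z : Z) : X := (Function.surjInv h.surjective z).2

theorem page_proj (h : IsBookMap q w) (z : Z) : q (h.page z, h.proj z) = z :=
  Function.surjInv_eq h.surjective z

theorem proj_apply (h : IsBookMap q w) (c : C) (x : X) : h.proj (q (c, x)) = x := by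
  rcases (h.eq_iff _ _).mp (h.page_proj (q (c, x))) with h' | ⟨h1, h2⟩
  · exact congrArg Prod.snd h'
  · exact h1.trans h2.symm

theorem page_apply (h : IsBookMap q w) (c : C) {x : X} (hx : x ≠ w) : h.page (q (c, x)) = c := by
  rcases (h.eq_iff _ _).mp (h.page_proj (q (c, x))) with h' | ⟨-, h2⟩
  · exact congrArg Prod.fst h'
  · exact absurd h2 hx

theorem apply_top (h : IsBookMap q w) (c d : C) : q (c, w) = q (d, w) :=
  (h.eq_iff _ _).mpr (Or.inr ⟨rfl, rfl⟩)

theorem eq_top (h : IsBookMap q w) (c : C) {z : Z} (hz : h.proj z = w) : z = q (c, w) := by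
  rw [← h.page_proj z, hz, h.apply_top]

theorem continuous_leaf (h : IsBookMap q w) (c : C) : Continuous fun x => q (c, x) :=
  h.continuous.comp (by fun_prop)

theorem leaf_injective (h : IsBookMap q w) (c : C) : Function.Injective fun x => q (c, x) :=
  fun x y hxy => by rw [← h.proj_apply c x, ← h.proj_apply c y]; exact congrArg h.proj hxy

variable [CompactSpace C] [CompactSpace X] [T2Space Z]

theorem isQuotientMap (h : IsBookMap q w) : IsQuotientMap q :=
  h.continuous.isClosedMap.isQuotientMap h.continuous h.surjective

theorem continuous_proj (h : IsBookMap q w) : Continuous h.proj :=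
  h.isQuotientMap.continuous_iff.mpr <| continuous_snd.congr fun a => (h.proj_apply a.1 a.2).symm

theorem continuousOn_page (h : IsBookMap q w) : ContinuousOn h.page {z | h.proj z ≠ w} := by
  refine fun z hz => ContinuousAt.continuousWithinAt ?_
  refine continuousAt_def.mpr fun N hN => ?_
  obtain ⟨U, hUN, hU, hzU⟩ := mem_nhds_iff.mp hN
  have hcl : IsClosed (q '' (Uᶜ ×ˢ univ)) :=
    h.continuous.isClosedMap _ (hU.isClosed_compl.prod isClosed_univ)
  have hmem : z ∈ (q '' (Uᶜ ×ˢ univ))ᶜ := by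
    rintro ⟨⟨c, x⟩, ⟨hc, -⟩, rfl⟩
    rw [mem_ofPred, h.proj_apply] at hz
    exact hc (by rwa [h.page_apply c hz] at hzU)
  filter_upwards [hcl.isOpen_compl.mem_nhds hmem] with z' hz'
  refine hUN (by_contra fun hc => hz' ⟨(h.page z', h.proj z'), ⟨hc, mem_univ _⟩, h.page_proj z'⟩)

variable [TotallyDisconnectedSpace C]

theorem page_eq_of_isPreconnected (h : IsBookMap q w) {P : Set Z} (hP : IsPreconnected P)
    (hw : ∀ z ∈ P, h.proj z ≠ w) {y z : Z} (hy : y ∈ P) (hz : z ∈ P) : h.page y = h.page z :=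
  (hP.image _ (h.continuousOn_page.mono hw)).subsingleton
    (mem_image_of_mem _ hy) (mem_image_of_mem _ hz)

theorem isPeg_proj [T2Space X] (h : IsBookMap q w) {E : Type*} [NormedAddCommGroup E]
    [NormedSpace ℝ E] {S : Set E} (hS : StarConvex ℝ 0 S) (hSc : IsCompact S) (h0 : 0 ∈ S) {z : Z}
    (hz : h.proj z ≠ w) (hp : IsPeg S z) : IsPeg S (h.proj z) := by
  obtain ⟨f, hf, hfi, rfl⟩ := hp
  have hev : ∀ᶠ p in 𝓝[S] (0 : E), h.proj (f p) ≠ w :=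
    (h.continuous_proj.continuousAt.comp_continuousWithinAt (hf 0 h0)).eventually_ne hz
  obtain ⟨δ, hδ, hball⟩ := Metric.mem_nhdsWithin_iff.mp hev
  obtain ⟨R, hR, hSR⟩ := hSc.isBounded.exists_pos_norm_le
  set ε : ℝ := min 1 (δ / (2 * R)) with hε
  have hε0 : 0 < ε := lt_min one_pos (by positivity)
  have hε1 : ε ≤ 1 := min_le_left _ _
  have hεS : MapsTo (fun p : E => ε • p) S S := fun p hp => hS.smul_mem hp hε0.le hε1
  have hne : ∀ p ∈ S, h.proj (f (ε • p)) ≠ w := by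
    refine fun p hp => hball ⟨?_, hεS hp⟩
    have h1 : ε * R ≤ δ / (2 * R) * R := mul_le_mul_of_nonneg_right (min_le_right _ _) hR.le
    have h2 : δ / (2 * R) * R = δ / 2 := by field_simp
    have h3 := mul_le_mul_of_nonneg_left (hSR p hp) hε0.le
    rw [mem_ball_zero_iff, norm_smul, Real.norm_of_nonneg hε0.le]
    linarith
  have hcont : ContinuousOn (fun p : E => f (ε • p)) S := hf.comp (by fun_prop) hεS
  have hconn : IsPreconnected S := hS.isPathConnected h0 |>.isConnected.isPreconnected
  refine ⟨fun p => h.proj (f (ε • p)), h.continuous_proj.comp_continuousOn hcont, ?_, by simp⟩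
  intro a ha b hb hab
  have hpage : h.page (f (ε • a)) = h.page (f (ε • b)) :=
    h.page_eq_of_isPreconnected (hconn.image _ hcont) (by rintro _ ⟨p, hp, rfl⟩; exact hne p hp)
      (mem_image_of_mem _ ha) (mem_image_of_mem _ hb)
  have hfab : f (ε • a) = f (ε • b) := by
    rw [← h.page_proj (f (ε • a)), ← h.page_proj (f (ε • b)), hpage]
    exact congrArg (fun x => q (_, x)) hab
  exact smul_right_injective E hε0.ne' (hfi (hεS ha) (hεS hb) hfab)

theorem isPreconnected_leaf_preimage [T2Space C] [T2Space X] (h : IsBookMap q w) {P : Set Z}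
    (hPc : IsCompact P) (hP : IsPreconnected P) (c : C) :
    IsPreconnected ((fun x => q (c, x)) ⁻¹' P) := by
  classical
  by_cases hw : ∀ z ∈ P, h.proj z ≠ w
  · rcases ((fun x => q (c, x)) ⁻¹' P).eq_empty_or_nonempty with he | ⟨x, hx⟩
    · rw [he]; exact isPreconnected_empty
    convert hP.image h.proj h.continuous_proj.continuousOn using 1
    refine Subset.antisymm (fun y hy => ⟨_, hy, h.proj_apply c y⟩) ?_
    rintro _ ⟨z, hz, rfl⟩
    have hxw : x ≠ w := by simpa [h.proj_apply] using hw _ hx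
    have hpage := h.page_eq_of_isPreconnected hP hw hz hx
    rw [h.page_apply c hxw] at hpage
    rw [mem_preimage, ← hpage, h.page_proj]
    exact hz
  push Not at hw
  obtain ⟨v, hvP, hv⟩ := hw
  let I := {N : Set C // c ∈ N ∧ IsClopen N}
  let g : I → Z → X := fun N z => if h.page z ∈ N.1 then h.proj z else w
  have hgq : ∀ (N : I) a, g N (q a) = if a.1 ∈ N.1 then a.2 else w := by
    rintro N ⟨d, x⟩
    by_cases hx : x = w
    · simp [g, hx, h.proj_apply]
    · simp [g, h.proj_apply, h.page_apply d hx]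
  have hg : ∀ N : I, Continuous (g N) := fun N => by
    refine h.isQuotientMap.continuous_iff.mpr (Continuous.congr ?_ fun a => (hgq N a).symm)
    refine Continuous.if ?_ continuous_snd continuous_const
    intro a ha
    have hcl : IsClopen {a : C × X | a.1 ∈ N.1} := N.2.2.preimage continuous_fst
    rw [hcl.frontier_eq] at ha
    exact ha.elim
  have : Nonempty I := ⟨⟨univ, mem_univ _, isClopen_univ⟩⟩
  have hgv : ∀ N, g N v = w := fun N => by simp [g, hv]
  have hgmem : ∀ (N : I) (x : X), x ∈ g N '' P ↔ x = w ∨ ∃ d ∈ N.1, q (d, x) ∈ P := by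
    intro N x
    constructor
    · rintro ⟨z, hz, rfl⟩
      by_cases hd : h.page z ∈ N.1
      · exact Or.inr ⟨_, hd, by simpa [g, hd, h.page_proj] using hz⟩
      · exact Or.inl (by simp [g, hd])
    · rintro (rfl | ⟨d, hd, hx⟩)
      · exact ⟨v, hvP, hgv N⟩
      · exact ⟨_, hx, by rw [hgq, if_pos hd]⟩
  have hInter : (fun x => q (c, x)) ⁻¹' P = ⋂ N : I, g N '' P := by
    ext x
    simp only [mem_iInter, hgmem, mem_preimage]
    constructor
    · exact fun hx N => Or.inr ⟨c, N.2.1, hx⟩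
    · intro hx
      by_cases hxw : x = w
      · rw [hxw, ← h.eq_top c hv]; exact hvP
      have hcl : IsClosed {d : C | q (d, x) ∈ P} :=
        hPc.isClosed.preimage (h.continuous.comp (by fun_prop : Continuous fun d : C => (d, x)))
      refine hcl.closure_subset ((mem_closure_iff_nhds_basis (nhds_basis_clopen c)).mpr ?_)
      rintro N ⟨hcN, hN⟩
      obtain ⟨d, hd, hdx⟩ := (hx ⟨N, hcN, hN⟩).resolve_left hxw
      exact ⟨d, hdx, hd⟩
  rw [hInter]
  refine IsPreconnected.iInter_of_directed ?_ (fun N => (hPc.image (hg N)).isClosed)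
    fun N => hP.image _ (hg N).continuousOn
  intro N M
  refine ⟨⟨N.1 ∩ M.1, ⟨N.2.1, M.2.1⟩, N.2.2.inter M.2.2⟩, ?_, ?_⟩ <;>
  · intro x
    simp only [hgmem]
    exact Or.imp_right fun ⟨d, hd, hx⟩ => ⟨d, by first | exact hd.1 | exact hd.2, hx⟩

theorem isPreconnected_inter_s7 [T2Space C] [T2Space X] (h : IsBookMap q w)
    (hX : IsDendroid (univ : Set X)) {P R : Set Z}
    (hPc : IsCompact P) (hP : IsPreconnected P) (hRc : IsCompact R) (hR : IsPreconnected R) :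
    IsPreconnected (P ∩ R) := by
  have hleaf : ∀ c, IsPreconnected ((fun x => q (c, x)) '' ((fun x => q (c, x)) ⁻¹' (P ∩ R))) :=
    fun c => (hX.isPreconnected_inter_s7
      (hPc.isClosed.preimage (h.continuous_leaf c)).isCompact
      (h.isPreconnected_leaf_preimage hPc hP c)
      (hRc.isClosed.preimage (h.continuous_leaf c)).isCompact
      (h.isPreconnected_leaf_preimage hRc hR c)).image _ (h.continuous_leaf c).continuousOn
  have hmem : ∀ z ∈ P ∩ R,
      z ∈ (fun x => q (h.page z, x)) '' ((fun x => q (h.page z, x)) ⁻¹' (P ∩ R)) := fun z hz =>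
    ⟨h.proj z, by rw [mem_preimage, h.page_proj]; exact hz, h.page_proj z⟩
  by_cases hv : ∃ v ∈ P ∩ R, h.proj v = w
  · obtain ⟨v, hvPR, hv⟩ := hv
    refine isPreconnected_of_forall v fun z hz =>
      ⟨_, image_preimage_subset _ _, ?_, hmem z hz, hleaf (h.page z)⟩
    exact ⟨w, by rw [mem_preimage, ← h.eq_top _ hv]; exact hvPR, (h.eq_top _ hv).symm⟩
  push Not at hv
  refine isPreconnected_of_forall_pair fun y hy z hz =>
    ⟨_, image_preimage_subset _ _, hmem y hy, ?_, hleaf (h.page y)⟩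
  have hpage : h.page y = h.page z := by
    by_cases hPw : ∀ z ∈ P, h.proj z ≠ w
    · exact h.page_eq_of_isPreconnected hP hPw hy.1 hz.1
    by_cases hRw : ∀ z ∈ R, h.proj z ≠ w
    · exact h.page_eq_of_isPreconnected hR hRw hy.2 hz.2
    push Not at hPw hRw
    obtain ⟨a, haP, ha⟩ := hPw
    obtain ⟨b, hbR, hb⟩ := hRw
    have hab : a = b := (h.eq_top (h.page a) ha).trans (h.eq_top (h.page a) hb).symm
    exact absurd ha (hv a ⟨haP, hab ▸ hbR⟩)
  rw [hpage]
  exact hmem z hz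

theorem isArcFromTo_proj [T2Space X] (h : IsBookMap q w) {A : Set Z} {v z : Z} (hv : h.proj v = w)
    (hA : IsArcFromTo A v z) :
    IsArcFromTo (h.proj '' A) w (h.proj z) ∧
      A = (fun x => q (h.page z, x)) '' (h.proj '' A) := by
  rcases hA with ⟨rfl, rfl⟩ | ⟨hvz, hA⟩
  · refine ⟨Or.inl ⟨hv.symm, by simp [hv]⟩, ?_⟩
    simp [h.page_proj]
  obtain ⟨γ, hγ, rfl⟩ := (isArc_with_endpoints_iff hvz).mp hA
  have hγw : ∀ t, h.proj (γ t) = w → t = 0 := fun t ht =>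
    hγ (((h.eq_top (h.page z) ht).trans (h.eq_top _ hv).symm).trans γ.source.symm)
  have hpage : ∀ t, q (h.page z, h.proj (γ t)) = γ t := by
    intro t
    rcases eq_or_ne t 0 with rfl | ht
    · rw [γ.source, hv]; exact (h.eq_top _ hv).symm
    have hconn : IsPreconnected (γ '' Ioi 0) :=
      isPreconnected_Ioi.image _ γ.continuous.continuousOn
    have := h.page_eq_of_isPreconnected hconn
      (by rintro _ ⟨s, hs, rfl⟩ hsw; exact (ne_of_gt hs) (hγw s hsw))
      (mem_image_of_mem γ (unitInterval.pos_iff_ne_zero.mpr ht))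
      (mem_image_of_mem γ (mem_Ioi.mpr (zero_lt_one : (0 : unitInterval) < 1)))
    rw [γ.target] at this
    rw [← this, h.page_proj]
  have hzw : w ≠ h.proj z := fun hz =>
    hvz ((h.eq_top (h.page z) hv).trans (h.eq_top _ hz.symm).symm)
  constructor
  · refine Or.inr ⟨hzw, (isArc_with_endpoints_iff hzw).mpr
      ⟨(γ.map h.continuous_proj).cast hv.symm rfl, ?_, ?_⟩⟩
    · intro s t hst
      apply hγ
      rw [← hpage s, ← hpage t]
      exact congrArg (fun x => q (_, x)) hst
    · change range (h.proj ∘ γ) = _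
      rw [range_comp]
  · ext y
    constructor
    · rintro ⟨t, rfl⟩
      exact ⟨_, ⟨_, ⟨t, rfl⟩, rfl⟩, hpage t⟩
    · rintro ⟨_, ⟨_, ⟨t, rfl⟩, rfl⟩, rfl⟩
      exact ⟨t, (hpage t).symm⟩

end Basic

section Metric

variable {C X Z : Type*} [MetricSpace X] [MetricSpace Z] {w : X}

theorem hausdorffDist_leaf_image_le [UniformSpace C] [CompactSpace C] [CompactSpace X]
    {q : C × X → Z} (h : IsBookMap q w) {ε : ℝ} (hε : 0 < ε) :
    ∃ u ∈ uniformity C, ∃ δ > 0, ∀ c d, (c, d) ∈ u → ∀ A B : Set X, A.Nonempty → B.Nonempty →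
      Metric.hausdorffDist A B < δ →
      Metric.hausdorffDist ((fun x => q (c, x)) '' A) ((fun x => q (d, x)) '' B) ≤ ε := by
  have hu := CompactSpace.uniformContinuous_of_continuous h.continuous
    (Metric.dist_mem_uniformity hε)
  obtain ⟨u, hu, s, hs, hus⟩ := entourageProd_subset hu
  obtain ⟨δ, hδ, hδs⟩ := Metric.mem_uniformity_dist.mp hs
  have hclose : ∀ c d, (c, d) ∈ u → ∀ x y, dist x y < δ → dist (q (c, x)) (q (d, y)) < ε :=
    fun c d hcd x y hxy => @hus ((c, x), (d, y)) ⟨hcd, hδs hxy⟩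
  refine ⟨u, hu, δ, hδ, fun c d hcd A B hA hB hAB => ?_⟩
  have hfin : Metric.hausdorffEDist A B ≠ ⊤ :=
    Metric.hausdorffEDist_ne_top_of_nonempty_of_bounded hA hB
      (isCompact_univ.isBounded.subset (subset_univ _))
      (isCompact_univ.isBounded.subset (subset_univ _))
  refine Metric.hausdorffDist_le_of_mem_dist hε.le ?_ ?_
  · rintro _ ⟨x, hx, rfl⟩
    obtain ⟨y, hy, hxy⟩ := Metric.exists_dist_lt_of_hausdorffDist_lt hx hAB hfin
    exact ⟨_, ⟨y, hy, rfl⟩, (hclose c d hcd x y hxy).le⟩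
  · rintro _ ⟨y, hy, rfl⟩
    obtain ⟨x, hx, hxy⟩ := Metric.exists_dist_lt_of_hausdorffDist_lt' hy hAB hfin
    exact ⟨_, ⟨x, hx, rfl⟩, by rw [dist_comm]; exact (hclose c d hcd x y hxy).le⟩

theorem isArcwiseConnected [TopologicalSpace C] {q : C × X → Z} (h : IsBookMap q w)
    (hX : IsArcwiseConnected (univ : Set X)) : IsArcwiseConnected (univ : Set Z) := by
  have hpath : ∀ x y : X, x ≠ y → ∃ γ : Path x y, Function.Injective γ := fun x y hxy => by
    obtain ⟨A, -, hA⟩ := hX x (mem_univ _) y (mem_univ _) hxy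
    obtain ⟨γ, hγ, -⟩ := (isArc_with_endpoints_iff hxy).mp hA
    exact ⟨γ, hγ⟩
  rintro y - z - hyz
  suffices ∃ γ : Path y z, Function.Injective γ by
    obtain ⟨γ, hγ⟩ := this
    exact ⟨range γ, subset_univ _, (isArc_with_endpoints_iff hyz).mpr ⟨γ, hγ, rfl⟩⟩
  have same : ∀ c a b, q (c, a) ≠ q (c, b) →
      ∃ γ : Path (q (c, a)) (q (c, b)), Function.Injective γ := fun c a b hab => by
    obtain ⟨γ, hγ⟩ := hpath a b fun hab' => hab (by rw [hab'])
    exact ⟨γ.map (h.continuous_leaf c), (h.leaf_injective c).comp hγ⟩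
  obtain ⟨⟨c, a⟩, rfl⟩ := h.surjective y
  obtain ⟨⟨d, b⟩, rfl⟩ := h.surjective z
  rcases eq_or_ne c d with rfl | hcd
  · exact same c a b hyz
  rcases eq_or_ne a w with rfl | ha
  · rw [h.apply_top c d] at hyz ⊢; exact same d a b hyz
  rcases eq_or_ne b w with rfl | hb
  · rw [h.apply_top d c] at hyz ⊢; exact same c a b hyz
  obtain ⟨γ, hγ⟩ := hpath a w ha
  obtain ⟨δ, hδ⟩ := hpath w b hb.symm
  let γ' : Path (q (c, a)) (q (c, w)) := γ.map (h.continuous_leaf c)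
  let δ' : Path (q (c, w)) (q (d, b)) := (δ.map (h.continuous_leaf d)).cast (h.apply_top c d) rfl
  refine ⟨γ'.trans δ', Path.trans_injective ((h.leaf_injective c).comp hγ)
    ((h.leaf_injective d).comp hδ) fun s t hst => ?_⟩
  rcases (h.eq_iff (c, γ s) (d, δ t)).mp hst with h' | ⟨-, h'⟩
  · exact absurd (congrArg Prod.fst h') hcd
  · exact hδ (h'.trans δ.source.symm)

theorem isLelekFan [UniformSpace C] [CompactSpace C] [T2Space C] [TotallyDisconnectedSpace C]
    {q : C × X → Z} (h : IsBookMap q w) (hX : IsLelekFan (univ : Set X) w) {v : Z}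
    (hv : h.proj v = w) : IsLelekFan (univ : Set Z) v := by
  obtain ⟨⟨⟨⟨hdend, hram⟩, hw⟩, hsmooth⟩, hdense⟩ := hX
  have : CompactSpace X := ⟨hdend.1.1⟩
  have hXconn : IsPreconnected (univ : Set X) := hdend.1.2.isPreconnected
  have hZcomp : CompactSpace Z := h.surjective.compactSpace h.continuous
  have hleafv : ∀ c, q (c, w) = v := fun c => (h.eq_top c hv).symm
  refine ⟨⟨⟨⟨⟨⟨isCompact_univ, ⟨v, mem_univ v⟩, ?_⟩, h.isArcwiseConnected hdend.2.1, ?_⟩, ?_⟩, ?_⟩,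
    ?_⟩, ?_⟩
  · refine isPreconnected_of_forall v fun z _ => ⟨_, subset_univ _, ?_, ?_,
      hXconn.image _ (h.continuous_leaf (h.page z)).continuousOn⟩
    · exact ⟨w, mem_univ _, hleafv _⟩
    · exact ⟨h.proj z, mem_univ _, h.page_proj z⟩
  · rintro A - hA P R hP hR rfl
    refine ⟨?_, h.isPreconnected_inter_s7 hdend hP.1 hP.2.2 hR.1 hR.2.2⟩
    have := isPreconnected_closed_iff.mp hA.2.2 P R hP.1.isClosed hR.1.isClosed subset_rfl
      (by simpa [union_inter_cancel_left] using hP.2.1)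
      (by simpa [union_inter_cancel_right] using hR.2.1)
    exact this.mono inter_subset_right
  · have key : ∀ z, IsRamificationPoint univ z → z = v := fun z hz => by
      by_contra hzv
      have hzw : h.proj z ≠ w := fun hzw =>
        hzv ((h.eq_top (h.page z) hzw).trans (hleafv _))
      exact hzw (hram _ _ (isRamificationPoint_univ_iff.mpr
        (h.isPeg_proj triodModel_starConvex triodModel_isCompact triod_top_mem hzw
          (isRamificationPoint_univ_iff.mp hz))) hw)
    exact fun x y hx hy => (key x hx).trans (key y hy).symm
  · rw [← hleafv (h.page v)]
    exact isRamificationPoint_univ_iff.mpr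
      ((isRamificationPoint_univ_iff.mp hw).map (h.continuous_leaf _) (h.leaf_injective _))
  · intro z _ zs _ hzs A _ hA As hAs
    obtain ⟨hA', hAeq⟩ := h.isArcFromTo_proj hv hA
    have hAs' := fun n => h.isArcFromTo_proj hv (hAs n).2
    have hlim := hsmooth (h.proj z) (mem_univ _) (fun n => h.proj (zs n)) (fun _ => mem_univ _)
      ((h.continuous_proj.tendsto z).comp hzs) _ (subset_univ _) hA'
      (fun n => h.proj '' As n) fun n => ⟨subset_univ _, (hAs' n).1⟩
    have hpage : ∃ d : ℕ → C, (∀ n, A = (fun x => q (d n, x)) '' (h.proj '' A)) ∧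
        ∀ u ∈ uniformity C, ∀ᶠ n in atTop, (h.page (zs n), d n) ∈ u := by
      by_cases hz : h.proj z = w
      · refine ⟨fun n => h.page (zs n), fun n => ?_, fun u hu =>
          Eventually.of_forall fun n => refl_mem_uniformity hu⟩
        have hAw : h.proj '' A = {w} := by
          rcases hA' with ⟨-, h'⟩ | ⟨h', -⟩
          · exact h'
          · exact absurd hz.symm h'
        rw [hAw, image_singleton] at hAeq ⊢
        rw [hAeq, hleafv, hleafv]
      · refine ⟨fun _ => h.page z, fun _ => hAeq, fun u hu => ?_⟩
        have hopen : IsOpen {z | h.proj z ≠ w} := isOpen_ne.preimage h.continuous_proj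
        have := ((h.continuousOn_page.continuousAt (hopen.mem_nhds hz)).tendsto.comp hzs)
        exact this.eventually (mem_nhds_right _ hu)
    obtain ⟨d, hd, hdu⟩ := hpage
    rw [Metric.tendsto_atTop']
    intro ε hε
    obtain ⟨u, hu, δ, hδ, H⟩ := h.hausdorffDist_leaf_image_le (half_pos hε)
    obtain ⟨N, hN⟩ := eventually_atTop.mp ((hdu u hu).and (hlim.eventually_lt_const hδ))
    refine ⟨N, fun n hn => ?_⟩
    have hle := H _ _ (hN n hn.le).1 _ _ (hAs' n).1.nonempty hA'.nonempty (hN n hn.le).2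
    rw [← hd n, ← (hAs' n).2] at hle
    rw [Real.dist_0_eq_abs, abs_of_nonneg Metric.hausdorffDist_nonneg]
    linarith
  · rintro z -
    rw [← h.page_proj z]
    refine map_mem_closure (f := fun x => q (h.page z, x)) (h.continuous_leaf _)
      (hdense (mem_univ (h.proj z))) fun e he => ?_
    have hew : e ≠ w := by
      rintro rfl
      exact isEndpoint_univ_iff.mp he (isRamificationPoint_univ_iff.mp hw).interval_of_triodModel
    refine isEndpoint_univ_iff.mpr fun hp => isEndpoint_univ_iff.mp he ?_
    have := h.isPeg_proj ((convex_Icc (-1 : ℝ) 1).starConvex (by simp)) isCompact_Icc (by simp)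
      (by rwa [h.proj_apply]) hp
    rwa [h.proj_apply] at this

end Metric

end IsBookMap

theorem isBookMap_quotient {X Z : Type*} [TopologicalSpace X] [TopologicalSpace Z] (w : X)
    (φ : Quotient (lelekConeSetoid X w) ≃ₜ Z) :
    IsBookMap (fun a => φ (Quotient.mk (lelekConeSetoid X w) a)) w where
  continuous := φ.continuous.comp continuous_quotient_mk'
  surjective := φ.surjective.comp Quotient.mk_surjective
  eq_iff _ _ := φ.injective.eq_iff.trans Quotient.eq

/-- if `L'` is a Lelek fan with top `w` and `C` is the Cantor set, then
`(C × L')/∼`, where `∼` collapses `C × {w}` to a point, is a Lelek fan (with that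
point as its top, in any metric realization of the quotient). -/
theorem stmt7 {X : Type*} [MetricSpace X] (w : X)
    (hL : IsLelekFan (Set.univ : Set X) w)
    (Z : Type*) [MetricSpace Z]
    (φ : Quotient (lelekConeSetoid X w) ≃ₜ Z) :
    IsLelekFan (Set.univ : Set Z) (φ (Quotient.mk _ ((fun _ => false), w))) := by
  exact (isBookMap_quotient w φ).isLelekFan hL ((isBookMap_quotient w φ).proj_apply _ w)
end
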